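/- arXiv:1411.4282 — 5 statements merged into one kernel-verified Lean document; each statement's English description precedes it below -/
import Mathlib

section
/- Let Q be a nonempty finite index set. For each q ∈ Q let A_q be an r_q × p_q real matrix each of whose rows contains exactly one entry equal to 1, exactly one entry equal to -1, and zeros elsewhere; let b_q ∈ ℝ^{r_q}; let π_q, π̃_q ∈ ℝ^{p_q} have nonnegative entries and ℓ₁-norm at most 1, and suppose ‖π̃_q − π_q‖₁ ≤ Δ. Set r = max_q r_q and b = max_q ‖b_q‖₂, and define f = (1/|Q|) Σ_{q∈Q} ‖(A_q π_q + b_q)₊‖₂² and f^δ = (1/|Q|) Σ_{q∈Q} ‖(A_q π̃_q + b_q)₊‖₂². Then |f^δ − f| ≤ Δ √(2r) (2√(2r) + 2b). -/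
open Finset

theorem abs_sq_max_zero_sub_sq_max_zero_le (u v : ℝ) :
    |max u 0 ^ 2 - max v 0 ^ 2| ≤ |u - v| * (|u| + |v|) := by
  have hdiff : |max u 0 - max v 0| ≤ |u - v| := abs_max_sub_max_le_abs u v 0
  have hu : max u 0 ≤ |u| := max_le (le_abs_self u) (abs_nonneg u)
  have hv : max v 0 ≤ |v| := max_le (le_abs_self v) (abs_nonneg v)
  have hsum : |max u 0 + max v 0| ≤ |u| + |v| := by
    rw [abs_of_nonneg (by positivity)]
    exact add_le_add hu hv
  calc |max u 0 ^ 2 - max v 0 ^ 2| = |max u 0 - max v 0| * |max u 0 + max v 0| := by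
        rw [← abs_mul]; ring_nf
    _ ≤ |u - v| * (|u| + |v|) := by gcongr

theorem Matrix.abs_mulVec_le_sum_abs {m n : Type*} [Fintype n] {A : Matrix m n ℝ} {i : m}
    (hA : ∀ j, |A i j| ≤ 1) (x : n → ℝ) : |A.mulVec x i| ≤ ∑ j, |x j| := by
  refine (Finset.abs_sum_le_sum_abs _ _).trans (Finset.sum_le_sum fun j _ => ?_)
  rw [abs_mul]
  exact mul_le_of_le_one_left (abs_nonneg _) (hA j)

theorem sum_abs_le_sqrt_card_mul_sqrt {ι : Type*} [Fintype ι] (b : ι → ℝ) :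
    ∑ i, |b i| ≤ √(Fintype.card ι) * √(∑ i, b i ^ 2) := by
  simpa using Real.sum_mul_le_sqrt_mul_sqrt Finset.univ (fun _ : ι => (1 : ℝ)) fun i => |b i|

/-- Perturbing the argument of `x ↦ ‖(A x + b)₊‖₂²` within the `ℓ₁` unit ball changes its value
by at most a multiple of the `ℓ₁` size of the perturbation. -/
theorem abs_sum_sq_max_mulVec_add_sub_le {m n : Type*} [Fintype m] [Fintype n]
    {A : Matrix m n ℝ} (hA : ∀ i j, |A i j| ≤ 1) (b : m → ℝ) {x y : n → ℝ}
    (hx : ∑ j, |x j| ≤ 1) (hy : ∑ j, |y j| ≤ 1) {Δ : ℝ} (hΔ : ∑ j, |x j - y j| ≤ Δ) :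
    |∑ i, max (A.mulVec x i + b i) 0 ^ 2 - ∑ i, max (A.mulVec y i + b i) 0 ^ 2| ≤
      Δ * (2 * Fintype.card m + 2 * (√(Fintype.card m) * √(∑ i, b i ^ 2))) := by
  have hΔ0 : 0 ≤ Δ := (Finset.sum_nonneg fun j _ => abs_nonneg _).trans hΔ
  have hrow : ∀ i, |max (A.mulVec x i + b i) 0 ^ 2 - max (A.mulVec y i + b i) 0 ^ 2| ≤
      Δ * (2 + 2 * |b i|) := by
    intro i
    have hdiff : |A.mulVec x i + b i - (A.mulVec y i + b i)| ≤ Δ := by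
      rw [add_sub_add_right_eq_sub, ← Pi.sub_apply, ← Matrix.mulVec_sub]
      exact (Matrix.abs_mulVec_le_sum_abs (hA i) _).trans hΔ
    have hAx := (Matrix.abs_mulVec_le_sum_abs (hA i) x).trans hx
    have hAy := (Matrix.abs_mulVec_le_sum_abs (hA i) y).trans hy
    have hsum : |A.mulVec x i + b i| + |A.mulVec y i + b i| ≤ 2 + 2 * |b i| := by
      linarith [abs_add_le (A.mulVec x i) (b i), abs_add_le (A.mulVec y i) (b i)]
    exact (abs_sq_max_zero_sub_sq_max_zero_le _ _).trans (by gcongr)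
  rw [← Finset.sum_sub_distrib]
  calc _ ≤ ∑ i, Δ * (2 + 2 * |b i|) :=
        (Finset.abs_sum_le_sum_abs _ _).trans (Finset.sum_le_sum fun i _ => hrow i)
    _ = Δ * (2 * Fintype.card m + 2 * ∑ i, |b i|) := by
        rw [← Finset.mul_sum, Finset.sum_add_distrib, ← Finset.mul_sum]
        simp [mul_comm]
    _ ≤ _ := by
        gcongr
        exact sum_abs_le_sqrt_card_mul_sqrt b

/-- error in the objective value caused by approximating the stationary
distributions.  For each query `q`, `A q` is an `r_q × p_q` matrix whose rows have exactly
one `1`, one `-1` and zeros elsewhere, `π q` and `πt q` are entrywise-nonnegative vectors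
of ℓ₁-norm at most 1 with `‖πt q − π q‖₁ ≤ Δ`.  With `r = max_q r_q`,
`b = max_q ‖b q‖₂`, `f = (1/|Q|) Σ_q ‖(A_q π_q + b_q)₊‖₂²` and
`fδ = (1/|Q|) Σ_q ‖(A_q π̃_q + b_q)₊‖₂²`, one has `|fδ − f| ≤ Δ √(2r) (2√(2r) + 2b)`. -/
theorem objective_error_bound {Q : Type*} [Fintype Q] [Nonempty Q]
    (rdim pdim : Q → ℕ)
    (A : ∀ q : Q, Matrix (Fin (rdim q)) (Fin (pdim q)) ℝ)
    (hA : ∀ q : Q, ∀ i : Fin (rdim q), ∃ j₁ j₂ : Fin (pdim q), j₁ ≠ j₂ ∧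
      A q i j₁ = 1 ∧ A q i j₂ = -1 ∧ ∀ j : Fin (pdim q), j ≠ j₁ → j ≠ j₂ → A q i j = 0)
    (b : ∀ q : Q, Fin (rdim q) → ℝ)
    (π πt : ∀ q : Q, Fin (pdim q) → ℝ)
    (hπ0 : ∀ q j, 0 ≤ π q j) (hπt0 : ∀ q j, 0 ≤ πt q j)
    (hπ1 : ∀ q, ∑ j, |π q j| ≤ 1) (hπt1 : ∀ q, ∑ j, |πt q j| ≤ 1)
    (Δ : ℝ) (hΔ : ∀ q, ∑ j, |πt q j - π q j| ≤ Δ)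
    (r : ℕ) (hr : r = Finset.univ.sup' Finset.univ_nonempty rdim)
    (bmax : ℝ)
    (hb : bmax = Finset.univ.sup' Finset.univ_nonempty
      (fun q => Real.sqrt (∑ i, (b q i) ^ 2))) :
    |(1 / (Fintype.card Q : ℝ)) *
        ∑ q : Q, ∑ i, (max ((A q).mulVec (πt q) i + b q i) 0) ^ 2 -
      (1 / (Fintype.card Q : ℝ)) *
        ∑ q : Q, ∑ i, (max ((A q).mulVec (π q) i + b q i) 0) ^ 2| ≤
    Δ * Real.sqrt (2 * r) * (2 * Real.sqrt (2 * r) + 2 * bmax) := by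
  have hAbs : ∀ q i j, |A q i j| ≤ 1 := by
    intro q i j
    obtain ⟨j₁, j₂, -, h₁, h₂, h₀⟩ := hA q i
    by_cases hj₁ : j = j₁
    · simp [hj₁, h₁]
    by_cases hj₂ : j = j₂
    · simp [hj₂, h₂]
    simp [h₀ j hj₁ hj₂]
  have hquery : ∀ q, |∑ i, (max ((A q).mulVec (πt q) i + b q i) 0) ^ 2 -
      ∑ i, (max ((A q).mulVec (π q) i + b q i) 0) ^ 2| ≤
      Δ * √(2 * r) * (2 * √(2 * r) + 2 * bmax) := by
    intro q
    have hΔ0 : 0 ≤ Δ := (Finset.sum_nonneg fun j _ => abs_nonneg _).trans (hΔ q)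
    have hrq : (rdim q : ℝ) ≤ r := by
      rw [hr]
      exact_mod_cast Finset.le_sup' rdim (Finset.mem_univ q)
    have hbq : √(∑ i, b q i ^ 2) ≤ bmax := by
      rw [hb]
      exact Finset.le_sup' (fun q => √(∑ i, b q i ^ 2)) (Finset.mem_univ q)
    have hr0 : (0 : ℝ) ≤ r := r.cast_nonneg
    have hsqrt : √(rdim q : ℝ) ≤ √(2 * r) := Real.sqrt_le_sqrt (by linarith)
    have hmul : √(rdim q : ℝ) * √(∑ i, b q i ^ 2) ≤ √(2 * r) * bmax := by gcongr
    have hsq : √(2 * r : ℝ) * √(2 * r) = 2 * r := Real.mul_self_sqrt (by positivity)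
    have hbound := abs_sum_sq_max_mulVec_add_sub_le (hAbs q) (b q) (hπt1 q) (hπ1 q) (hΔ q)
    rw [Fintype.card_fin] at hbound
    rw [mul_assoc]
    refine hbound.trans (mul_le_mul_of_nonneg_left ?_ hΔ0)
    linarith
  have hcard : (0 : ℝ) < Fintype.card Q := by exact_mod_cast Fintype.card_pos
  rw [← mul_sub, ← Finset.sum_sub_distrib, abs_mul, abs_of_pos (by positivity), one_div,
    inv_mul_le_iff₀ hcard]
  refine (Finset.abs_sum_le_sum_abs _ _).trans ?_
  simpa using Finset.sum_le_sum fun q (_ : q ∈ Finset.univ) => hquery q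
end

section
/- Let P be a p × p row-stochastic matrix, let π⁰ ∈ ℝ^p be a probability vector, let α ∈ (0,1), and let π be the unique solution of π = α π⁰ + (1−α) Pᵀ π. For N ∈ ℕ define the truncated vector π̃^N = (α / (1 − (1−α)^{N+1})) Σ_{i=0}^{N} (1−α)^i (Pᵀ)^i π⁰. Then ‖π̃^N − π‖₁ ≤ 2 (1−α)^{N+1}. -/
open Matrix Finset

/-- The transpose of a row-stochastic matrix is a contraction in the `ℓ₁` norm. -/
theorem sum_abs_transpose_mulVec_le {n : Type*} [Fintype n] {P : Matrix n n ℝ}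
    (hP0 : ∀ i j, 0 ≤ P i j) (hP1 : ∀ i, ∑ j, P i j = 1) (x : n → ℝ) :
    ∑ j, |Pᵀ.mulVec x j| ≤ ∑ j, |x j| :=
  calc ∑ j, |Pᵀ.mulVec x j| ≤ ∑ j, ∑ i, P i j * |x i| := by
        refine Finset.sum_le_sum fun j _ => (Finset.abs_sum_le_sum_abs _ _).trans_eq ?_
        exact Finset.sum_congr rfl fun i _ => by
          rw [abs_mul]
          exact congrArg (· * |x i|) (abs_of_nonneg (hP0 i j))
    _ = ∑ i, |x i| := by
        rw [Finset.sum_comm]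
        exact Finset.sum_congr rfl fun i _ => by rw [← Finset.sum_mul, hP1, one_mul]

theorem sum_abs_transpose_pow_mulVec_le {n : Type*} [Fintype n] [DecidableEq n]
    {P : Matrix n n ℝ} (hP0 : ∀ i j, 0 ≤ P i j) (hP1 : ∀ i, ∑ j, P i j = 1) (k : ℕ)
    (x : n → ℝ) : ∑ j, |(Pᵀ ^ k).mulVec x j| ≤ ∑ j, |x j| := by
  induction k with
  | zero => simp
  | succ k ih =>
    rw [pow_succ', ← Matrix.mulVec_mulVec]
    exact (sum_abs_transpose_mulVec_le hP0 hP1 _).trans ih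

/-- Iterating the affine fixed-point equation `x = v + b A x`. -/
theorem eq_sum_add_pow_smul_mulVec {n R : Type*} [Fintype n] [DecidableEq n] [CommRing R]
    {A : Matrix n n R} {v x : n → R} {b : R} (hx : x = v + b • A.mulVec x) (k : ℕ) :
    x = ∑ i ∈ Finset.range k, b ^ i • (A ^ i).mulVec v + b ^ k • (A ^ k).mulVec x := by
  induction k with
  | zero => simp
  | succ k ih =>
    have h : b ^ k • (A ^ k).mulVec x =
        b ^ k • (A ^ k).mulVec v + b ^ (k + 1) • (A ^ (k + 1)).mulVec x := by
      conv_lhs => rw [hx]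
      rw [Matrix.mulVec_add, Matrix.mulVec_smul, Matrix.mulVec_mulVec, smul_add, smul_smul,
        ← pow_succ, ← pow_succ]
    rw [Finset.sum_range_succ, add_assoc, ← h]
    exact ih

/-- if `π` solves `π = α π⁰ + (1−α) Pᵀ π` and
`π̃^N = (α/(1−(1−α)^{N+1})) Σ_{i=0}^N (1−α)^i (Pᵀ)^i π⁰`, then
`‖π̃^N − π‖₁ ≤ 2 (1−α)^{N+1}`. -/
theorem truncated_pagerank_error (p : ℕ) (P : Matrix (Fin p) (Fin p) ℝ)
    (hP0 : ∀ i j, 0 ≤ P i j) (hP1 : ∀ i, ∑ j, P i j = 1)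
    (π0 : Fin p → ℝ) (hπ00 : ∀ i, 0 ≤ π0 i) (hπ01 : ∑ i, π0 i = 1)
    (α : ℝ) (hα : α ∈ Set.Ioo (0 : ℝ) 1)
    (π : Fin p → ℝ) (hπ : π = α • π0 + (1 - α) • Pᵀ.mulVec π)
    (N : ℕ) :
    ∑ j : Fin p,
      |((α / (1 - (1 - α) ^ (N + 1))) •
          ∑ i ∈ Finset.range (N + 1), (1 - α) ^ i • (Pᵀ ^ i).mulVec π0) j - π j| ≤
      2 * (1 - α) ^ (N + 1) := by
  obtain ⟨hα0, hα1⟩ := hα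
  set b := 1 - α with hb
  have hb0 : 0 ≤ b := by linarith
  set q := b ^ (N + 1) with hq
  have hq0 : 0 ≤ q := pow_nonneg hb0 _
  have hq1 : 0 < 1 - q := sub_pos.2 (pow_lt_one₀ hb0 (by linarith) N.succ_ne_zero)
  have hπ0 : ∑ j, |π0 j| = 1 := by simpa only [abs_of_nonneg (hπ00 _)] using hπ01
  have hπ1 : ∑ j, |π j| ≤ 1 := by
    have h : ∑ j, |π j| ≤ α * ∑ j, |π0 j| + b * ∑ j, |Pᵀ.mulVec π j| := by
      rw [Finset.mul_sum, Finset.mul_sum, ← Finset.sum_add_distrib]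
      refine Finset.sum_le_sum fun j _ => ?_
      conv_lhs => rw [hπ]
      refine (abs_add_le _ _).trans_eq ?_
      simp [abs_mul, abs_of_pos hα0, abs_of_nonneg hb0]
    have h' := mul_le_mul_of_nonneg_left (sum_abs_transpose_mulVec_le hP0 hP1 π) hb0
    rw [hπ0] at h
    nlinarith
  set S := ∑ i ∈ Finset.range (N + 1), b ^ i • (Pᵀ ^ i).mulVec π0 with hS
  have hS1 : α * ∑ j, |S j| ≤ 1 - q := by
    have h : ∑ j, |S j| ≤ ∑ i ∈ Finset.range (N + 1), b ^ i :=
      calc ∑ j, |S j| ≤ ∑ j, ∑ i ∈ Finset.range (N + 1), b ^ i * |(Pᵀ ^ i).mulVec π0 j| := by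
            refine Finset.sum_le_sum fun j _ => ?_
            rw [hS, Finset.sum_apply]
            refine (Finset.abs_sum_le_sum_abs _ _).trans_eq (Finset.sum_congr rfl fun i _ => ?_)
            rw [Pi.smul_apply, smul_eq_mul, abs_mul, abs_of_nonneg (pow_nonneg hb0 i)]
        _ = ∑ i ∈ Finset.range (N + 1), b ^ i * ∑ j, |(Pᵀ ^ i).mulVec π0 j| := by
            rw [Finset.sum_comm]
            simp only [Finset.mul_sum]
        _ ≤ ∑ i ∈ Finset.range (N + 1), b ^ i :=
            Finset.sum_le_sum fun i _ => mul_le_of_le_one_right (pow_nonneg hb0 i)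
              ((sum_abs_transpose_pow_mulVec_le hP0 hP1 i π0).trans_eq hπ0)
    have hgeom := mul_neg_geom_sum b (N + 1)
    rw [show 1 - b = α by simp [hb]] at hgeom
    exact (mul_le_mul_of_nonneg_left h hα0.le).trans_eq hgeom
  have hrec : π = α • S + q • (Pᵀ ^ (N + 1)).mulVec π := by
    have h := eq_sum_add_pow_smul_mulVec hπ (N + 1)
    simpa only [Matrix.mulVec_smul, smul_comm _ α, ← Finset.smul_sum] using h
  have herr (j : Fin p) : ((α / (1 - q)) • S) j - π j =
      q * (α / (1 - q) * S j - (Pᵀ ^ (N + 1)).mulVec π j) := by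
    have h := congrFun hrec j
    simp only [Pi.add_apply, Pi.smul_apply, smul_eq_mul] at h ⊢
    rw [h]
    field_simp
    ring
  have hc : 0 ≤ α / (1 - q) := by positivity
  calc ∑ j, |((α / (1 - q)) • S) j - π j|
      ≤ ∑ j, q * (α / (1 - q) * |S j| + |(Pᵀ ^ (N + 1)).mulVec π j|) := by
        refine Finset.sum_le_sum fun j _ => ?_
        rw [herr, abs_mul, abs_of_nonneg hq0]
        refine mul_le_mul_of_nonneg_left ((abs_sub _ _).trans_eq ?_) hq0
        rw [abs_mul, abs_of_nonneg hc]
    _ = q * (α / (1 - q) * ∑ j, |S j| + ∑ j, |(Pᵀ ^ (N + 1)).mulVec π j|) := by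
        rw [← Finset.mul_sum, Finset.sum_add_distrib, ← Finset.mul_sum]
    _ ≤ q * (1 + 1) := by
        refine mul_le_mul_of_nonneg_left (add_le_add ?_ ?_) hq0
        · rwa [div_mul_eq_mul_div, div_le_one hq1]
        · exact (sum_abs_transpose_pow_mulVec_le hP0 hP1 _ π).trans hπ1
    _ = 2 * q := by ring
end

section
/- Let f : ℝ^m → ℝ be in C^{1,1}_L, let δ ≥ 0 and let δ̃ : ℝ^m → ℝ satisfy |δ̃(x)| ≤ δ for all x; set f^δ(x) = f(x) + δ̃(x). Fix μ > 0 and let s be a random vector uniformly distributed over the unit sphere S = {t ∈ ℝ^m : ‖t‖₂ = 1}, and define the biased gradient-free oracle g_μ^δ(x) = (m/μ)(f^δ(x+μs) − f^δ(x)) s. Then for every x ∈ ℝ^m, E[‖g_μ^δ(x)‖₂²] ≤ m² μ² L² + 4 m ‖∇f(x)‖₂² + 8 δ² m² / μ². -/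
open MeasureTheory Metric

open scoped RealInnerProductSpace

section

open scoped Pointwise

variable {E : Type*} [NormedAddCommGroup E] [InnerProductSpace ℝ E]

/-- The quadratic bound on the first-order Taylor remainder of a function whose gradient is
`L`-Lipschitz. -/
theorem abs_sub_sub_inner_gradient_le [CompleteSpace E] {f : E → ℝ} {L : ℝ}
    (hdiff : Differentiable ℝ f)
    (hlip : ∀ x y : E, ‖gradient f x - gradient f y‖ ≤ L * ‖x - y‖) (x v : E) :
    |f (x + v) - f x - ⟪gradient f x, v⟫| ≤ L / 2 * ‖v‖ ^ 2 := by
  have hφ : ∀ t : ℝ, HasDerivAt (fun t : ℝ ↦ f (x + t • v) - f x - t * ⟪gradient f x, v⟫)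
      ⟪gradient f (x + t • v) - gradient f x, v⟫ t := by
    intro t
    have hline : HasDerivAt (fun t : ℝ ↦ x + t • v) v t := by
      simpa using ((hasDerivAt_id t).smul_const v).const_add x
    have hf := (hdiff (x + t • v)).hasGradientAt.hasFDerivAt.comp_hasDerivAt t hline
    rw [InnerProductSpace.toDual_apply_apply] at hf
    have hlin : HasDerivAt (fun t : ℝ ↦ t * ⟪gradient f x, v⟫) ⟪gradient f x, v⟫ t := by
      simpa using (hasDerivAt_id t).mul_const ⟪gradient f x, v⟫
    rw [inner_sub_left]
    exact (hf.sub_const (f x)).sub hlin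
  have hB : ∀ t : ℝ, HasDerivAt (fun t : ℝ ↦ L / 2 * ‖v‖ ^ 2 * t ^ 2) (L * ‖v‖ ^ 2 * t) t := by
    intro t
    refine ((hasDerivAt_pow 2 t).const_mul (L / 2 * ‖v‖ ^ 2)).congr_deriv ?_
    push_cast
    ring
  have hbound : ∀ t ∈ Set.Ico (0 : ℝ) 1,
      ‖⟪gradient f (x + t • v) - gradient f x, v⟫‖ ≤ L * ‖v‖ ^ 2 * t := by
    intro t ht
    calc ‖⟪gradient f (x + t • v) - gradient f x, v⟫‖
        ≤ ‖gradient f (x + t • v) - gradient f x‖ * ‖v‖ := norm_inner_le_norm _ _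
      _ ≤ L * ‖x + t • v - x‖ * ‖v‖ := by gcongr; exact hlip _ _
      _ = L * ‖v‖ ^ 2 * t := by
        rw [add_sub_cancel_left, norm_smul, Real.norm_of_nonneg ht.1]
        ring
  have h := image_norm_le_of_norm_deriv_right_le_deriv_boundary
    (fun t _ ↦ (hφ t).continuousAt.continuousWithinAt) (fun t _ ↦ (hφ t).hasDerivWithinAt)
    (by simp) hB hbound (Set.right_mem_Icc.2 zero_le_one)
  simpa using h

theorem continuous_inner_sq_sphere (v : E) :
    Continuous fun s : sphere (0 : E) 1 ↦ ⟪v, (s : E)⟫ ^ 2 := by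
  fun_prop

variable [FiniteDimensional ℝ E] [MeasurableSpace E] [BorelSpace E]

/-- The surface measure of the unit sphere is invariant under linear isometries. -/
theorem measurePreserving_toSphere_linearIsometryEquiv (R : E ≃ₗᵢ[ℝ] E) :
    MeasurePreserving
      (fun s : sphere (0 : E) 1 ↦ (⟨R s, by simp⟩ : sphere (0 : E) 1))
      (volume : Measure E).toSphere (volume : Measure E).toSphere := by
  have hmeas : Measurable (fun s : sphere (0 : E) 1 ↦ (⟨R s, by simp⟩ : sphere (0 : E) 1)) :=
    (by fun_prop : Continuous _).measurable
  refine ⟨hmeas, ?_⟩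
  ext s hs
  rw [Measure.map_apply hmeas hs, Measure.toSphere_apply' _ (hmeas hs),
    Measure.toSphere_apply' _ hs,
    ← R.measurePreserving.measure_preimage_emb R.toHomeomorph.measurableEmbedding
      (Set.Ioo (0 : ℝ) 1 • ((Subtype.val : sphere (0 : E) 1 → E) '' s))]
  congr 2
  ext y
  simp only [Set.mem_smul, Set.mem_image, Set.mem_preimage]
  constructor
  · rintro ⟨r, hr, _, ⟨u, hu, rfl⟩, rfl⟩
    exact ⟨r, hr, _, ⟨_, hu, rfl⟩, by simp⟩
  · rintro ⟨r, hr, _, ⟨u, hu, rfl⟩, hy⟩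
    refine ⟨r, hr, R.symm u, ⟨⟨R.symm u, by simp⟩, by simpa using hu, rfl⟩, ?_⟩
    rw [← map_smul, hy, R.symm_apply_apply]

theorem integrable_inner_sq_toSphere (v : E) :
    Integrable (fun s : sphere (0 : E) 1 ↦ ⟪v, (s : E)⟫ ^ 2) (volume : Measure E).toSphere :=
  (continuous_inner_sq_sphere v).integrable_of_hasCompactSupport
    (HasCompactSupport.of_compactSpace _)

theorem integral_inner_sq_toSphere_eq_of_norm_eq {v w : E} (h : ‖v‖ = ‖w‖) :
    ∫ s : sphere (0 : E) 1, ⟪v, (s : E)⟫ ^ 2 ∂(volume : Measure E).toSphere =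
      ∫ s : sphere (0 : E) 1, ⟪w, (s : E)⟫ ^ 2 ∂(volume : Measure E).toSphere := by
  have hR := Submodule.reflection_sub h
  set R : E ≃ₗᵢ[ℝ] E := (ℝ ∙ (v - w))ᗮ.reflection
  have hmp := measurePreserving_toSphere_linearIsometryEquiv R
  conv_rhs => rw [← hmp.map_eq]
  rw [integral_map hmp.measurable.aemeasurable
    (continuous_inner_sq_sphere w).aestronglyMeasurable]
  simp only [← hR, R.inner_map_map]

/-- The second moment of a linear functional on the unit sphere. -/
theorem finrank_mul_integral_inner_sq_toSphere (v : E) :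
    Module.finrank ℝ E *
        ∫ s : sphere (0 : E) 1, ⟪v, (s : E)⟫ ^ 2 ∂(volume : Measure E).toSphere =
      ‖v‖ ^ 2 * (volume : Measure E).toSphere.real Set.univ := by
  set b := stdOrthonormalBasis ℝ E
  calc Module.finrank ℝ E *
        ∫ s : sphere (0 : E) 1, ⟪v, (s : E)⟫ ^ 2 ∂(volume : Measure E).toSphere
      = ∑ i, ∫ s : sphere (0 : E) 1, ⟪‖v‖ • b i, (s : E)⟫ ^ 2
          ∂(volume : Measure E).toSphere := by
        rw [Finset.sum_congr rfl fun i _ ↦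
          integral_inner_sq_toSphere_eq_of_norm_eq (v := ‖v‖ • b i) (w := v)
            (by simp [norm_smul])]
        simp
    _ = ∫ s : sphere (0 : E) 1, ‖v‖ ^ 2 ∂(volume : Measure E).toSphere := by
        rw [← integral_finsetSum _ fun i _ ↦ integrable_inner_sq_toSphere _]
        refine integral_congr_ae (.of_forall fun s ↦ ?_)
        simp [real_inner_smul_left, mul_pow, ← Finset.mul_sum, b.sum_sq_inner_right]
    _ = ‖v‖ ^ 2 * (volume : Measure E).toSphere.real Set.univ := by
        rw [integral_const, smul_eq_mul, mul_comm]

end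

/-- if `f ∈ C^{1,1}_L`, `|δ̃(x)| ≤ δ`, `f^δ = f + δ̃`, `μ > 0` and `s` is
uniform on the unit sphere, then the biased gradient-free oracle
`g_μ^δ(x) = (m/μ)(f^δ(x+μs) − f^δ(x)) s` satisfies
`E[‖g_μ^δ(x)‖₂²] ≤ m²μ²L² + 4m‖∇f(x)‖₂² + 8δ²m²/μ²`.  The expectation is the average
with respect to the surface measure `volume.toSphere` on the unit sphere. -/
theorem expectation_norm_sq_oracle_bound (m : ℕ) (hm : 1 ≤ m) (L : ℝ)
    (f : EuclideanSpace ℝ (Fin m) → ℝ)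
    (hdiff : Differentiable ℝ f)
    (hlip : ∀ x y : EuclideanSpace ℝ (Fin m),
      ‖gradient f x - gradient f y‖ ≤ L * ‖x - y‖)
    (δ : ℝ) (hδ : 0 ≤ δ)
    (δt : EuclideanSpace ℝ (Fin m) → ℝ) (hδt : ∀ x, |δt x| ≤ δ)
    (μ : ℝ) (hμ : 0 < μ) (x : EuclideanSpace ℝ (Fin m)) :
    ⨍ s : sphere (0 : EuclideanSpace ℝ (Fin m)) 1,
        ‖(((m : ℝ) / μ) *
            ((f (x + μ • (s : EuclideanSpace ℝ (Fin m))) +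
                δt (x + μ • (s : EuclideanSpace ℝ (Fin m)))) - (f x + δt x))) •
          (s : EuclideanSpace ℝ (Fin m))‖ ^ 2
        ∂((volume : Measure (EuclideanSpace ℝ (Fin m))).toSphere) ≤
      (m : ℝ) ^ 2 * μ ^ 2 * L ^ 2 + 4 * m * ‖gradient f x‖ ^ 2 +
        8 * δ ^ 2 * m ^ 2 / μ ^ 2 := by
  have : NeZero m := ⟨by omega⟩
  have hm0 : (m : ℝ) ≠ 0 := NeZero.ne _
  set G := gradient f x
  set σ := (volume : Measure (EuclideanSpace ℝ (Fin m))).toSphere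
  have : NeZero σ := ⟨Measure.toSphere_ne_zero _⟩
  have hσ : 0 < σ.real Set.univ := measureReal_univ_pos
  set c : ℝ := (m : ℝ) ^ 2 * μ ^ 2 * L ^ 2 + 8 * δ ^ 2 * m ^ 2 / μ ^ 2 with hc
  have hpt : ∀ s : sphere (0 : EuclideanSpace ℝ (Fin m)) 1,
      ‖(((m : ℝ) / μ) *
          ((f (x + μ • (s : EuclideanSpace ℝ (Fin m))) +
              δt (x + μ • (s : EuclideanSpace ℝ (Fin m)))) - (f x + δt x))) •
        (s : EuclideanSpace ℝ (Fin m))‖ ^ 2 ≤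
      c + 4 * m ^ 2 * ⟪G, (s : EuclideanSpace ℝ (Fin m))⟫ ^ 2 := by
    intro s
    have hs : ‖(s : EuclideanSpace ℝ (Fin m))‖ = 1 := norm_eq_of_mem_sphere s
    have hT := abs_sub_sub_inner_gradient_le hdiff hlip x (μ • (s : EuclideanSpace ℝ (Fin m)))
    rw [norm_smul, hs, mul_one, Real.norm_eq_abs, sq_abs, real_inner_smul_right] at hT
    set y := x + μ • (s : EuclideanSpace ℝ (Fin m))
    set p := ⟪G, (s : EuclideanSpace ℝ (Fin m))⟫
    have hD : |δt y - δt x| ≤ 2 * δ :=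
      (abs_sub _ _).trans (by linarith [hδt y, hδt x])
    have hT2 := sq_le_sq' (abs_le.1 hT).1 (abs_le.1 hT).2
    have hD2 := sq_le_sq' (abs_le.1 hD).1 (abs_le.1 hD).2
    have hsum : (f y + δt y - (f x + δt x)) ^ 2 ≤
        L ^ 2 * μ ^ 4 + 4 * μ ^ 2 * p ^ 2 + 8 * δ ^ 2 := by
      nlinarith [sq_nonneg (f y - f x - μ * p - μ * p),
        sq_nonneg (f y - f x - (δt y - δt x))]
    rw [norm_smul, hs, mul_one, Real.norm_eq_abs, sq_abs, mul_pow]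
    calc ((m : ℝ) / μ) ^ 2 * (f y + δt y - (f x + δt x)) ^ 2
        ≤ ((m : ℝ) / μ) ^ 2 * (L ^ 2 * μ ^ 4 + 4 * μ ^ 2 * p ^ 2 + 8 * δ ^ 2) := by gcongr
      _ = c + 4 * m ^ 2 * p ^ 2 := by
        rw [hc]
        field_simp
        ring
  have hint : Integrable (fun s : sphere (0 : EuclideanSpace ℝ (Fin m)) 1 ↦
      4 * (m : ℝ) ^ 2 * ⟪G, (s : EuclideanSpace ℝ (Fin m))⟫ ^ 2) σ :=
    (integrable_inner_sq_toSphere G).const_mul _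
  have hmoment := finrank_mul_integral_inner_sq_toSphere G
  rw [finrank_euclideanSpace_fin] at hmoment
  rw [average_eq, smul_eq_mul, inv_mul_le_iff₀ hσ]
  refine (integral_mono_of_nonneg (.of_forall fun s ↦ by positivity)
    ((integrable_const c).add hint) (.of_forall hpt)).trans_eq ?_
  simp only [Pi.add_apply]
  rw [integral_add (integrable_const c) hint, integral_const, integral_const_mul, smul_eq_mul, hc]
  linear_combination (4 * (m : ℝ)) * hmoment
end

section
/- Let f : ℝ^m → ℝ be in C^{1,1}_L and μ > 0, and let f_μ(x) = E[f(x+μξ)] where ξ is uniformly distributed over the unit ball B = {t ∈ ℝ^m : ‖t‖₂ ≤ 1}. Then for every x ∈ ℝ^m, ∇f_μ(x) = E[(m/μ)(f(x+μs) − f(x)) s], where s is uniformly distributed over the unit sphere S = {t ∈ ℝ^m : ‖t‖₂ = 1}; in other words, the random gradient-free oracle g_μ(x) = (m/μ)(f(x+μs) − f(x)) s is an unbiased estimator of ∇f_μ(x). -/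
open MeasureTheory Metric

section PolarCoordinates

variable {E : Type*} [NormedAddCommGroup E] [NormedSpace ℝ E] [FiniteDimensional ℝ E]
  [MeasurableSpace E] [BorelSpace E] (ν : Measure E) [ν.IsAddHaarMeasure]

theorem continuous_integral_sphere {F : ℝ → E → ℝ} (hF : Continuous F.uncurry) :
    Continuous fun r : ℝ ↦ ∫ s : sphere (0 : E) 1, F r s ∂ν.toSphere := by
  have h := continuous_parametric_integral_of_continuous (μ := ν.toSphere)
    (f := fun (r : ℝ) (s : sphere (0 : E) 1) ↦ F r s)
    (hF.comp (continuous_fst.prodMk (continuous_subtype_val.comp continuous_snd)))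
    isCompact_univ
  simpa using h

variable [Nontrivial E]

/-- Integration in polar coordinates. -/
theorem integral_eq_integral_Ioi_integral_sphere {F : E → ℝ} (hF : Integrable F ν) :
    ∫ ξ, F ξ ∂ν = ∫ r in Set.Ioi (0 : ℝ),
      r ^ (Module.finrank ℝ E - 1) * ∫ s : sphere (0 : E) 1, F (r • (s : E)) ∂ν.toSphere := by
  have hpres := ν.measurePreserving_homeomorphUnitSphereProd
  have hemb := (homeomorphUnitSphereProd E).measurableEmbedding
  let G : sphere (0 : E) 1 × Set.Ioi (0 : ℝ) → ℝ := fun p ↦ F ((p.2 : ℝ) • (p.1 : E))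
  have hG : ∀ ξ : ({0}ᶜ : Set E), G (homeomorphUnitSphereProd E ξ) = F ξ := by
    intro ξ
    have hξ : ‖(ξ : E)‖ ≠ 0 := norm_ne_zero_iff.2 ξ.2
    simp [G, smul_smul, hξ]
  have hGint : Integrable G (ν.toSphere.prod (.volumeIoiPow (Module.finrank ℝ E - 1))) := by
    rw [← hpres.integrable_comp_emb hemb]
    have h : IntegrableOn F ({0}ᶜ : Set E) ν := hF.integrableOn
    rw [integrableOn_iff_comap_subtypeVal (by measurability)] at h
    exact h.congr (.of_forall fun ξ ↦ (hG ξ).symm)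
  calc
    ∫ ξ, F ξ ∂ν = ∫ ξ : ({0}ᶜ : Set E), F ξ ∂(ν.comap (↑)) := by
      rw [integral_subtype_comap (measurableSet_singleton _).compl F,
        restrict_compl_singleton]
    _ = ∫ p, G p ∂(ν.toSphere.prod (.volumeIoiPow (Module.finrank ℝ E - 1))) := by
      rw [← hpres.integral_comp hemb]
      exact integral_congr_ae (.of_forall fun ξ ↦ (hG ξ).symm)
    _ = ∫ r : Set.Ioi (0 : ℝ), ∫ s : sphere (0 : E) 1, F ((r : ℝ) • (s : E)) ∂ν.toSphere
          ∂(.volumeIoiPow (Module.finrank ℝ E - 1)) := integral_prod_symm G hGint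
    _ = _ := by
      simp only [Measure.volumeIoiPow, ENNReal.ofReal]
      rw [integral_withDensity_eq_integral_smul,
        integral_subtype_comap measurableSet_Ioi fun a ↦
          Real.toNNReal (a ^ (Module.finrank ℝ E - 1)) •
            ∫ s : sphere (0 : E) 1, F (a • (s : E)) ∂ν.toSphere,
        setIntegral_congr_fun measurableSet_Ioi fun x hx ↦ ?_]
      · rw [NNReal.smul_def, Real.coe_toNNReal _ (pow_nonneg hx.out.le _), smul_eq_mul]
      · exact (measurable_subtype_coe.pow_const _).real_toNNReal

/-- The integral over the closed unit ball in polar coordinates. -/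
theorem setIntegral_closedBall_eq_intervalIntegral {F : E → ℝ} (hF : Continuous F) :
    ∫ ξ in closedBall (0 : E) 1, F ξ ∂ν = ∫ r in (0 : ℝ)..1,
      r ^ (Module.finrank ℝ E - 1) * ∫ s : sphere (0 : E) 1, F (r • (s : E)) ∂ν.toSphere := by
  have hint : IntegrableOn F (closedBall (0 : E) 1) ν :=
    hF.continuousOn.integrableOn_compact (isCompact_closedBall _ _)
  rw [← integral_indicator measurableSet_closedBall,
    integral_eq_integral_Ioi_integral_sphere ν (hint.integrable_indicator measurableSet_closedBall),
    intervalIntegral.integral_of_le zero_le_one, ← integral_indicator measurableSet_Ioi,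
    ← integral_indicator measurableSet_Ioc]
  congr 1 with r
  by_cases h0 : 0 < r
  · by_cases h1 : r ≤ 1
    · simp [Set.indicator, h0, h1, norm_smul, abs_of_pos h0]
    · simp [Set.indicator, h0, h1, norm_smul, abs_of_pos h0]
  · simp [Set.indicator, h0]

end PolarCoordinates

section RadialCutoff

/-- The antiderivative of `k` with derivative `-k` that vanishes at `R`. -/
theorem hasDerivAt_integral_left {k : ℝ → ℝ} (hk : Continuous k) (R t : ℝ) :
    HasDerivAt (fun t ↦ ∫ u in t..R, k u) (-k t) t :=
  intervalIntegral.integral_hasDerivAt_left (hk.intervalIntegrable _ _)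
    (hk.stronglyMeasurableAtFilter _ _) hk.continuousAt

variable {E : Type*} [NormedAddCommGroup E] [InnerProductSpace ℝ E]

theorem hasFDerivAt_norm_apply {x : E} (hx : x ≠ 0) :
    HasFDerivAt (fun y : E ↦ ‖y‖) (‖x‖⁻¹ • innerSL ℝ x) x := by
  have h := ((hasStrictFDerivAt_norm_sq x).hasFDerivAt).sqrt (by simpa using hx)
  simp only [Real.sqrt_sq (norm_nonneg _)] at h
  convert h using 1
  ext v
  simp
  ring

theorem contDiff_comp_norm {h : ℝ → ℝ} (hh : ContDiff ℝ 1 h)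
    (h0 : ∀ᶠ t in nhds 0, h t = h 0) : ContDiff ℝ 1 fun ξ : E ↦ h ‖ξ‖ := by
  rw [contDiff_iff_contDiffAt]
  intro x
  by_cases hx : x = 0
  · subst hx
    have : Filter.Tendsto (fun ξ : E ↦ ‖ξ‖) (nhds 0) (nhds 0) := by
      simpa using (continuous_norm (E := E)).tendsto 0
    exact contDiffAt_const.congr_of_eventuallyEq (this.eventually h0)
  · exact hh.contDiffAt.comp x (contDiffAt_norm ℝ hx)

theorem fderiv_comp_norm_apply {h : ℝ → ℝ} {h' : ℝ} {x : E} (hx : x ≠ 0)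
    (hh : HasDerivAt h h' ‖x‖) (v : E) :
    fderiv ℝ (fun ξ : E ↦ h ‖ξ‖) x v = h' * (‖x‖⁻¹ * inner ℝ x v) := by
  have := hh.comp_hasFDerivAt x (hasFDerivAt_norm_apply hx)
  have e := this.fderiv
  simp only [Function.comp_def] at e
  rw [e]
  simp

end RadialCutoff

section DivergenceTheorem

variable {E : Type*} [NormedAddCommGroup E] [InnerProductSpace ℝ E] [FiniteDimensional ℝ E]
  [Nontrivial E] [MeasurableSpace E] [BorelSpace E] (ν : Measure E) [ν.IsAddHaarMeasure]

/-- The divergence theorem on balls, tested against a function of the radius. -/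
theorem integral_Ioi_mul_integral_sphere_inner {g : E → ℝ} (hg : ContDiff ℝ 1 g) (v : E)
    {k : ℝ → ℝ} (hk : Continuous k) (hkc : HasCompactSupport k) (hk0 : tsupport k ⊆ Set.Ioi 0) :
    ∫ r in Set.Ioi (0 : ℝ), k r * (r ^ (Module.finrank ℝ E - 1) *
        ∫ s : sphere (0 : E) 1, g (r • (s : E)) * inner ℝ (s : E) v ∂ν.toSphere) =
      ∫ r in Set.Ioi (0 : ℝ), k r * ∫ t in (0 : ℝ)..r, t ^ (Module.finrank ℝ E - 1) *
        ∫ s : sphere (0 : E) 1, fderiv ℝ g (t • (s : E)) v ∂ν.toSphere := by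
  obtain ⟨R₀, hR₀⟩ := hkc.isCompact.isBounded.subset_closedBall 0
  obtain ⟨R, hR, hR0⟩ : ∃ R, R₀ < R ∧ 0 < R := ⟨max R₀ 0 + 1, by grind, by grind⟩
  have hkR : ∀ t, R ≤ t → k t = 0 := by
    intro t ht
    by_contra hne
    have := hR₀ (subset_tsupport k hne)
    rw [mem_closedBall_zero_iff, Real.norm_eq_abs] at this
    exact absurd (le_abs_self t) (by linarith)
  set h : ℝ → ℝ := fun t ↦ ∫ u in t..R, k u with h_def
  have hd : ∀ t, HasDerivAt h (-k t) t := hasDerivAt_integral_left hk R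
  have hhR : ∀ t, R ≤ t → h t = 0 := by
    intro t ht
    rw [h_def]
    refine intervalIntegral.integral_zero_ae (.of_forall fun u hu ↦ hkR u ?_)
    rw [Set.uIoc_of_ge ht] at hu
    exact hu.1.le
  have hh1 : ContDiff ℝ 1 h := by
    rw [contDiff_one_iff_deriv]
    refine ⟨fun t ↦ (hd t).differentiableAt, ?_⟩
    have : deriv h = fun t ↦ -k t := funext fun t ↦ (hd t).deriv
    rw [this]
    exact hk.neg
  have hh0 : ∀ᶠ t in nhds 0, h t = h 0 := by
    have hmem : (tsupport k)ᶜ ∈ nhds (0 : ℝ) :=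
      (isClosed_tsupport k).isOpen_compl.mem_nhds fun hm ↦ lt_irrefl (0 : ℝ) (hk0 hm)
    obtain ⟨δ, hδ, hball⟩ := Metric.mem_nhds_iff.1 hmem
    filter_upwards [ball_mem_nhds 0 hδ] with t ht
    simp only [h_def]
    rw [← intervalIntegral.integral_add_adjacent_intervals (hk.intervalIntegrable t 0)
      (hk.intervalIntegrable 0 R), add_eq_right]
    refine intervalIntegral.integral_zero_ae (.of_forall fun u hu ↦ ?_)
    refine image_eq_zero_of_notMem_tsupport (hball ?_)
    refine (convex_ball (0 : ℝ) δ).ordConnected.uIcc_subset ht (mem_ball_self hδ) ?_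
    exact Set.uIoc_subset_uIcc hu
  have hφ : ContDiff ℝ 1 fun ξ : E ↦ h ‖ξ‖ := contDiff_comp_norm hh1 hh0
  have hφc : HasCompactSupport fun ξ : E ↦ h ‖ξ‖ :=
    HasCompactSupport.intro (isCompact_closedBall (0 : E) R) fun ξ hξ ↦
      hhR _ (by simpa using (not_le.1 (by simpa using hξ)).le)
  have hDφ : Continuous fun ξ : E ↦ fderiv ℝ (fun ξ : E ↦ h ‖ξ‖) ξ v :=
    (hφ.continuous_fderiv (by simp)).clm_apply continuous_const
  have hDφc : HasCompactSupport fun ξ : E ↦ fderiv ℝ (fun ξ : E ↦ h ‖ξ‖) ξ v :=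
    hφc.fderiv_apply (𝕜 := ℝ) v
  have hDg : Continuous fun ξ : E ↦ fderiv ℝ g ξ v :=
    (hg.continuous_fderiv (by simp)).clm_apply continuous_const
  have hi1 : Integrable (fun ξ ↦ fderiv ℝ (fun ξ : E ↦ h ‖ξ‖) ξ v * g ξ) ν :=
    (hDφ.mul hg.continuous).integrable_of_hasCompactSupport hDφc.mul_right
  have hi2 : Integrable (fun ξ ↦ h ‖ξ‖ * fderiv ℝ g ξ v) ν :=
    (hφ.continuous.mul hDg).integrable_of_hasCompactSupport hφc.mul_right
  have hi3 : Integrable (fun ξ ↦ h ‖ξ‖ * g ξ) ν :=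
    (hφ.continuous.mul hg.continuous).integrable_of_hasCompactSupport hφc.mul_right
  have hparts := integral_mul_fderiv_eq_neg_fderiv_mul_of_integrable (v := v) hi1 hi2 hi3
    (fun ξ _ ↦ (hφ.differentiable (by simp)) ξ) (fun ξ _ ↦ (hg.differentiable (by simp)) ξ)
  rw [integral_eq_integral_Ioi_integral_sphere ν hi1,
    integral_eq_integral_Ioi_integral_sphere ν hi2, ← integral_neg] at hparts
  set b : ℝ → ℝ := fun t ↦ t ^ (Module.finrank ℝ E - 1) *
        ∫ s : sphere (0 : E) 1, fderiv ℝ g (t • (s : E)) v ∂ν.toSphere with b_def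
  have hb : Continuous b := (continuous_pow _).mul
    (continuous_integral_sphere ν (F := fun t s ↦ fderiv ℝ g (t • s) v)
      (hDg.comp (continuous_fst.smul continuous_snd)))
  have hleft : ∫ r in Set.Ioi (0 : ℝ), k r * (r ^ (Module.finrank ℝ E - 1) *
        ∫ s : sphere (0 : E) 1, g (r • (s : E)) * inner ℝ (s : E) v ∂ν.toSphere) =
      ∫ r in Set.Ioi (0 : ℝ), h r * b r := by
    refine Eq.trans ?_ (hparts.symm.trans ?_)
    · refine setIntegral_congr_fun measurableSet_Ioi fun r hr ↦ ?_
      have hr : 0 < r := hr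
      have hpt : ∀ s : sphere (0 : E) 1,
          fderiv ℝ (fun ξ : E ↦ h ‖ξ‖) (r • (s : E)) v * g (r • (s : E)) =
            -k r * (g (r • (s : E)) * inner ℝ (s : E) v) := by
        intro s
        have hs : ‖r • (s : E)‖ = r := by simp [norm_smul, abs_of_pos hr]
        rw [fderiv_comp_norm_apply (h' := -k r) (by rw [← norm_ne_zero_iff, hs]; exact hr.ne')
          (by rw [hs]; exact hd r), hs, real_inner_smul_left]
        field_simp
      simp only [hpt, integral_const_mul]
      ring
    · refine setIntegral_congr_fun measurableSet_Ioi fun r hr ↦ ?_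
      have hr : 0 < r := hr
      have hs : ∀ s : sphere (0 : E) 1, ‖r • (s : E)‖ = r := by simp [norm_smul, abs_of_pos hr]
      simp only [hs, integral_const_mul, b_def]
      ring
  have htrunc : ∀ F : ℝ → ℝ, (∀ t, R ≤ t → F t = 0) →
      ∫ r in Set.Ioi (0 : ℝ), F r = ∫ r in (0 : ℝ)..R, F r := by
    intro F hF
    rw [intervalIntegral.integral_of_le hR0.le]
    refine (setIntegral_eq_of_subset_of_forall_sdiff_eq_zero measurableSet_Ioi
      Set.Ioc_subset_Ioi_self fun t ht ↦ hF t ?_)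
    by_contra hlt
    exact ht.2 ⟨ht.1, (not_le.1 hlt).le⟩
  rw [hleft, htrunc _ fun t ht ↦ by rw [hhR t ht, zero_mul],
    htrunc _ fun t ht ↦ by rw [hkR t ht, zero_mul],
    intervalIntegral.integral_mul_deriv_eq_deriv_mul (v := fun r ↦ ∫ t in (0 : ℝ)..r, b t)
      (fun r _ ↦ hd r) (fun r _ ↦ hb.integral_hasStrictDerivAt 0 r |>.hasDerivAt)
      (hk.neg.intervalIntegrable _ _) (hb.intervalIntegrable _ _), hhR R le_rfl]
  simp

/-- The divergence theorem on the closed unit ball. -/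
theorem setIntegral_closedBall_fderiv_eq_integral_sphere {g : E → ℝ} (hg : ContDiff ℝ 1 g)
    (v : E) :
    ∫ ξ in closedBall (0 : E) 1, fderiv ℝ g ξ v ∂ν =
      ∫ s : sphere (0 : E) 1, g s * inner ℝ (s : E) v ∂ν.toSphere := by
  have hDg : Continuous fun ξ : E ↦ fderiv ℝ g ξ v :=
    (hg.continuous_fderiv (by simp)).clm_apply continuous_const
  rw [setIntegral_closedBall_eq_intervalIntegral ν hDg]
  set b : ℝ → ℝ := fun t ↦ t ^ (Module.finrank ℝ E - 1) *
        ∫ s : sphere (0 : E) 1, fderiv ℝ g (t • (s : E)) v ∂ν.toSphere with b_def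
  set a : ℝ → ℝ := fun r ↦ r ^ (Module.finrank ℝ E - 1) *
        ∫ s : sphere (0 : E) 1, g (r • (s : E)) * inner ℝ (s : E) v ∂ν.toSphere with a_def
  have hb : Continuous b := (continuous_pow _).mul
    (continuous_integral_sphere ν (F := fun t s ↦ fderiv ℝ g (t • s) v)
      (hDg.comp (continuous_fst.smul continuous_snd)))
  have ha : Continuous a := by
    refine (continuous_pow _).mul
      (continuous_integral_sphere ν (F := fun t s ↦ g (t • s) * inner ℝ s v) ?_)
    exact (hg.continuous.comp (continuous_fst.smul continuous_snd)).mul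
      (continuous_snd.inner continuous_const)
  have hB : Continuous fun r ↦ ∫ t in (0 : ℝ)..r, b t :=
    intervalIntegral.continuous_primitive (fun _ _ ↦ hb.intervalIntegrable _ _) 0
  have hae : ∀ᵐ r : ℝ, r ∈ Set.Ioi (0 : ℝ) → a r - ∫ t in (0 : ℝ)..r, b t = 0 := by
    refine isOpen_Ioi.ae_eq_zero_of_integral_contDiff_smul_eq_zero
      ((ha.sub hB).locallyIntegrable.locallyIntegrableOn _) fun k hk hkc hk0 ↦ ?_
    have hint : ∀ {F : ℝ → ℝ}, Continuous F → IntegrableOn (fun r ↦ k r * F r) (Set.Ioi 0) :=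
      fun hF ↦ ((hk.continuous.mul hF).integrable_of_hasCompactSupport hkc.mul_right).integrableOn
    rw [← setIntegral_eq_integral_of_forall_compl_eq_zero (s := Set.Ioi (0 : ℝ)) fun r hr ↦ by
      rw [image_eq_zero_of_notMem_tsupport fun hm ↦ hr (hk0 hm), zero_smul]]
    simp only [smul_eq_mul, mul_sub]
    rw [integral_sub (hint ha) (hint hB), sub_eq_zero]
    exact integral_Ioi_mul_integral_sphere_inner ν hg v hk.continuous hkc hk0
  have heq : Set.EqOn (fun r ↦ a r - ∫ t in (0 : ℝ)..r, b t) 0 (Set.Ioi 0) :=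
    Measure.eqOn_open_of_ae_eq ((ae_restrict_iff' measurableSet_Ioi).2 hae) isOpen_Ioi
      (ha.sub hB).continuousOn continuousOn_const
  have h1 := heq (Set.mem_Ioi.2 one_pos)
  simp only [Pi.zero_apply, sub_eq_zero] at h1
  rw [← h1]
  simp [a_def]

end DivergenceTheorem

section BallSmoothing

variable {E : Type*} [NormedAddCommGroup E] [InnerProductSpace ℝ E]

theorem contDiff_one_of_lipschitz_gradient [CompleteSpace E] {f : E → ℝ} {L : ℝ}
    (hdiff : Differentiable ℝ f)
    (hlip : ∀ x y : E, ‖gradient f x - gradient f y‖ ≤ L * ‖x - y‖) : ContDiff ℝ 1 f := by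
  have hgrad : Continuous (gradient f) := by
    refine (LipschitzWith.of_dist_le_mul (K := L.toNNReal) fun y z ↦ ?_).continuous
    rw [dist_eq_norm, dist_eq_norm]
    exact (hlip y z).trans
      (mul_le_mul_of_nonneg_right (Real.le_coe_toNNReal L) (norm_nonneg _))
  have hfderiv : fderiv ℝ f = fun y ↦ InnerProductSpace.toDual ℝ E (gradient f y) := by
    ext1 y
    simp [gradient]
  rw [contDiff_one_iff_fderiv, hfderiv]
  exact ⟨hdiff, (InnerProductSpace.toDual ℝ E).continuous.comp hgrad⟩

variable [FiniteDimensional ℝ E] [MeasurableSpace E] [BorelSpace E] (ν : Measure E)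
  [ν.IsAddHaarMeasure]

/-- Differentiation under the integral for averages over balls. -/
theorem hasFDerivAt_setIntegral_closedBall {f : E → ℝ} (hf : ContDiff ℝ 1 f) (μ : ℝ) (x : E) :
    HasFDerivAt (fun y ↦ ∫ ξ in closedBall (0 : E) 1, f (y + μ • ξ) ∂ν)
      (∫ ξ in closedBall (0 : E) 1, fderiv ℝ f (x + μ • ξ) ∂ν) x := by
  have hfderiv : Continuous (fderiv ℝ f) := hf.continuous_fderiv (by simp)
  have hcont : ∀ y : E, Continuous fun ξ : E ↦ y + μ • ξ := fun y ↦ by fun_prop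
  obtain ⟨C, hC⟩ := ((isCompact_closedBall x (1 + |μ|)).image hfderiv).isBounded.exists_norm_le
  refine hasFDerivAt_integral_of_dominated_of_fderiv_le (bound := fun _ ↦ C)
    (F' := fun y ξ ↦ fderiv ℝ f (y + μ • ξ)) (ball_mem_nhds x one_pos)
    (.of_forall fun y ↦ ?_) ?_ ?_ ?_ ?_ ?_
  · exact (hf.continuous.comp (hcont y)).aestronglyMeasurable
  · exact (hf.continuous.comp (hcont x)).continuousOn.integrableOn_compact
      (isCompact_closedBall _ _)
  · exact (hfderiv.comp (hcont x)).aestronglyMeasurable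
  · refine (ae_restrict_iff' measurableSet_closedBall).2 (.of_forall fun ξ hξ y hy ↦ ?_)
    refine hC _ ⟨y + μ • ξ, ?_, rfl⟩
    rw [mem_closedBall_zero_iff] at hξ
    rw [mem_ball, dist_eq_norm] at hy
    rw [mem_closedBall, dist_eq_norm, add_sub_right_comm]
    refine (norm_add_le _ _).trans (add_le_add hy.le ?_)
    rw [norm_smul, Real.norm_eq_abs]
    exact mul_le_of_le_one_right (abs_nonneg μ) hξ
  · exact integrableOn_const measure_closedBall_lt_top.ne
  · refine .of_forall fun ξ y _ ↦ ?_
    exact (hasFDerivAt_comp_add_right (μ • ξ)).2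
      ((hf.differentiable (by simp)) _).hasFDerivAt

/-- The gradient of the average of `f` over balls of radius `μ` as an average over the sphere. -/
theorem gradient_setAverage_closedBall [Nontrivial E] {f : E → ℝ} (hf : ContDiff ℝ 1 f)
    {μ : ℝ} (hμ : μ ≠ 0) (x : E) :
    gradient (fun y ↦ ⨍ ξ in closedBall (0 : E) 1, f (y + μ • ξ) ∂ν) x =
      ⨍ s : sphere (0 : E) 1,
        (((Module.finrank ℝ E : ℝ) / μ) * (f (x + μ • (s : E)) - f x)) • (s : E)
          ∂ν.toSphere := by
  have hdim : (Module.finrank ℝ E : ℝ) ≠ 0 := by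
    exact_mod_cast (Module.finrank_pos (R := ℝ) (M := E)).ne'
  have hdiff : Differentiable ℝ f := hf.differentiable (by simp)
  have hsphere : ν.toSphere.real Set.univ = Module.finrank ℝ E * ν.real (closedBall 0 1) := by
    rw [Measure.toSphere_real_apply_univ, Measure.addHaar_real_closedBall_eq_addHaar_real_ball]
  have hint : Integrable (fun s : sphere (0 : E) 1 ↦
      (((Module.finrank ℝ E : ℝ) / μ) * (f (x + μ • (s : E)) - f x)) • (s : E)) ν.toSphere := by
    have hc : Continuous fun s : sphere (0 : E) 1 ↦
        (((Module.finrank ℝ E : ℝ) / μ) * (f (x + μ • (s : E)) - f x)) • (s : E) := by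
      have := hdiff.continuous
      fun_prop
    exact hc.integrable_of_hasCompactSupport (.of_compactSpace _)
  have hint' : Integrable (fun ξ : E ↦ fderiv ℝ f (x + μ • ξ))
      (ν.restrict (closedBall (0 : E) 1)) := by
    have hc : Continuous fun ξ : E ↦ fderiv ℝ f (x + μ • ξ) :=
      (hf.continuous_fderiv (by simp)).comp (by fun_prop)
    exact hc.continuousOn.integrableOn_compact (isCompact_closedBall _ _)
  have hg : ContDiff ℝ 1 fun ξ : E ↦ f (x + μ • ξ) - f x :=
    (hf.comp (contDiff_const.add (contDiff_const.smul contDiff_id))).sub contDiff_const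
  simp only [setAverage_eq]
  refine ext_inner_right ℝ fun v ↦ ?_
  have hdg : ∀ ξ : E, fderiv ℝ (fun ξ : E ↦ f (x + μ • ξ) - f x) ξ v =
      μ * fderiv ℝ f (x + μ • ξ) v := by
    intro ξ
    have h := ((hdiff (x + μ • ξ)).hasFDerivAt.comp ξ
      (((hasFDerivAt_id ξ).const_smul μ).const_add x)).sub_const (f x)
    change fderiv ℝ (fun ξ ↦ (f ∘ fun ξ ↦ x + (μ • id) ξ) ξ - f x) ξ v = _
    rw [h.fderiv]
    simp
  have hdiv := setIntegral_closedBall_fderiv_eq_integral_sphere ν hg v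
  simp only [hdg, integral_const_mul] at hdiv
  have horacle : ∀ s : sphere (0 : E) 1,
      inner ℝ v ((((Module.finrank ℝ E : ℝ) / μ) * (f (x + μ • (s : E)) - f x)) • (s : E)) =
        ((Module.finrank ℝ E : ℝ) / μ) *
          ((f (x + μ • (s : E)) - f x) * inner ℝ (s : E) v) := by
    intro s
    rw [real_inner_smul_right, real_inner_comm, mul_assoc]
  have hderiv : HasFDerivAt (fun y ↦ (ν.real (closedBall (0 : E) 1))⁻¹ •
      ∫ ξ in closedBall (0 : E) 1, f (y + μ • ξ) ∂ν)
      ((ν.real (closedBall (0 : E) 1))⁻¹ • ∫ ξ in closedBall (0 : E) 1, fderiv ℝ f (x + μ • ξ) ∂ν)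
      x :=
    (hasFDerivAt_setIntegral_closedBall ν hf μ x).const_smul (ν.real (closedBall (0 : E) 1))⁻¹
  rw [average_eq, hsphere, real_inner_smul_left, gradient,
    InnerProductSpace.toDual_symm_apply, real_inner_comm, ← integral_inner hint, hderiv.fderiv,
    smul_apply, ContinuousLinearMap.integral_apply hint']
  simp only [horacle, integral_const_mul, ← hdiv, smul_eq_mul]
  field_simp

end BallSmoothing

/-- for `f ∈ C^{1,1}_L`, `μ > 0` and the smoothed function
`f_μ(x) = E[f(x+μξ)]` (`ξ` uniform on the unit ball), the random gradient-free oracle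
`g_μ(x) = (m/μ)(f(x+μs) − f(x))s` (`s` uniform on the unit sphere) is an unbiased
estimator of `∇f_μ(x)`: `∇f_μ(x) = E[(m/μ)(f(x+μs) − f(x))s]`. -/
theorem gradient_free_oracle_unbiased (m : ℕ) (hm : 1 ≤ m) (L : ℝ)
    (f : EuclideanSpace ℝ (Fin m) → ℝ)
    (hdiff : Differentiable ℝ f)
    (hlip : ∀ x y : EuclideanSpace ℝ (Fin m),
      ‖gradient f x - gradient f y‖ ≤ L * ‖x - y‖)
    (μ : ℝ) (hμ : 0 < μ)
    (fμ : EuclideanSpace ℝ (Fin m) → ℝ)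
    (hfμ : ∀ y : EuclideanSpace ℝ (Fin m),
      fμ y = ⨍ ξ in closedBall (0 : EuclideanSpace ℝ (Fin m)) 1, f (y + μ • ξ))
    (x : EuclideanSpace ℝ (Fin m)) :
    gradient fμ x =
      ⨍ s : sphere (0 : EuclideanSpace ℝ (Fin m)) 1,
        (((m : ℝ) / μ) * (f (x + μ • (s : EuclideanSpace ℝ (Fin m))) - f x)) •
          (s : EuclideanSpace ℝ (Fin m))
        ∂((volume : Measure (EuclideanSpace ℝ (Fin m))).toSphere) := by
  have : Nonempty (Fin m) := ⟨⟨0, hm⟩⟩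
  rw [funext hfμ, gradient_setAverage_closedBall volume
    (contDiff_one_of_lipschitz_gradient hdiff hlip) hμ.ne' x, finrank_euclideanSpace_fin]
end

section
/- Let m ≥ 1, L > 0, μ > 0, δ ≥ 0, R > 0. Let f : ℝ^m → ℝ be convex and in C^{1,1}_L with a global minimizer x* and f* = f(x*). Let δ̃ : ℝ^m → ℝ satisfy |δ̃(u)| ≤ δ for all u, and set f^δ = f + δ̃. Let x₀ ∈ ℝ^m satisfy ‖x₀ − x*‖₂ ≤ R, let X = {u ∈ ℝ^m : ‖u − x₀‖₂ ≤ 2R}, and let h = 1/(8 m L). Fix x ∈ X, let s be uniformly distributed over the unit sphere S = {t ∈ ℝ^m : ‖t‖₂ = 1}, set g_μ^δ(x) = (m/μ)(f^δ(x+μs) − f^δ(x)) s, and let x⁺ = Π_X(x − h g_μ^δ(x)), where Π_X is the Euclidean projection onto X. Then E[‖x⁺ − x*‖₂²] ≤ ‖x − x*‖₂² + R δ/(μ L) − (f(x) − f*)/(8 m L) + μ²(m+8)/(64 m) + δ²/(8 μ² L²). -/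
open MeasureTheory Metric

/-- The Euclidean projection onto the closed ball of radius `ρ` centered at `c`. -/
noncomputable def projBall {E : Type*} [NormedAddCommGroup E] [NormedSpace ℝ E]
    (c : E) (ρ : ℝ) (u : E) : E :=
  if ‖u - c‖ ≤ ρ then u else c + (ρ / ‖u - c‖) • (u - c)

section

open Module Set Filter Topology
open scoped RealInnerProductSpace Pointwise

section Auxiliary

variable {E : Type*} [NormedAddCommGroup E] [InnerProductSpace ℝ E]

/-- Projecting onto a closed ball does not increase the distance to points of that ball. -/
theorem norm_projBall_sub_le {c y : E} {ρ : ℝ} (hρ : 0 < ρ) (hy : ‖y - c‖ ≤ ρ) (u : E) :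
    ‖projBall c ρ u - y‖ ≤ ‖u - y‖ := by
  unfold projBall
  split_ifs with h
  · exact le_rfl
  push Not at h
  set w := u - c with hw
  set z := y - c with hz
  have hu : u - y = w - z := by simp [hw, hz]
  have hp : c + (ρ / ‖w‖) • w - y = (ρ / ‖w‖) • w - z := by simp only [hz]; abel
  have hw0 : 0 < ‖w‖ := hρ.trans h
  rw [hu, hp]
  clear_value w z
  refine le_of_sq_le_sq ?_ (norm_nonneg _)
  rw [norm_sub_sq_real, norm_sub_sq_real w z, norm_smul, inner_smul_left, Real.norm_eq_abs,
    abs_of_pos (by positivity), div_mul_cancel₀ _ hw0.ne']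
  have hi : ⟪w, z⟫ ≤ ‖w‖ * ρ :=
    (real_inner_le_norm w z).trans (mul_le_mul_of_nonneg_left hy hw0.le)
  have hk : ρ / ‖w‖ ≤ 1 := (div_le_one hw0).2 h.le
  have hkm : ρ / ‖w‖ * ‖w‖ = ρ := div_mul_cancel₀ _ hw0.ne'
  simp only [conj_trivial]
  generalize ρ / ‖w‖ = k at hk hkm
  subst hkm
  nlinarith [mul_le_mul_of_nonneg_left hi (sub_nonneg.2 hk), mul_self_nonneg ((1 - k) * ‖w‖)]

theorem hasDerivAt_add_smul (x d : E) (t : ℝ) :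
    HasDerivAt (fun t : ℝ ↦ x + t • d) d t := by
  simpa using ((hasDerivAt_id t).smul_const d).const_add x

variable [CompleteSpace E]

/-- The derivative of a function along a line, in terms of its gradient. -/
theorem HasGradientAt.hasDerivAt_comp {f : E → ℝ} {g : E} {γ : ℝ → E} {γ' : E} {t : ℝ}
    (hf : HasGradientAt f g (γ t)) (hγ : HasDerivAt γ γ' t) :
    HasDerivAt (fun t ↦ f (γ t)) ⟪g, γ'⟫ t := by
  exact hf.hasFDerivAt.comp_hasDerivAt t hγ

theorem hasGradientAt_inner (a x : E) : HasGradientAt (fun x ↦ ⟪a, x⟫) a x := by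
  rw [hasGradientAt_iff_hasFDerivAt]
  exact (innerSL ℝ a).hasFDerivAt

/-- A convex function lies above its tangent planes. -/
theorem ConvexOn.add_inner_gradient_le {f : E → ℝ} (hconv : ConvexOn ℝ univ f)
    (hdiff : Differentiable ℝ f) (x d : E) : f x + ⟪gradient f x, d⟫ ≤ f (x + d) := by
  have hline : ConvexOn ℝ univ fun t : ℝ ↦ f (x + t • d) := by
    have := hconv.comp_affineMap (AffineMap.lineMap x (x + d))
    simpa [Function.comp_def, AffineMap.lineMap_apply, add_comm] using this
  have hder : HasDerivAt (fun t : ℝ ↦ f (x + t • d)) ⟪gradient f x, d⟫ 0 :=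
    HasGradientAt.hasDerivAt_comp (by simpa using (hdiff x).hasGradientAt)
      (hasDerivAt_add_smul x d 0)
  have := hline.le_slope_of_hasDerivAt (mem_univ 0) (mem_univ 1) zero_lt_one hder
  simp [slope_def_field, -inner_gradient_left] at this
  linarith

theorem continuous_gradient_of_lipschitz {f : E → ℝ} {L : ℝ}
    (hlip : ∀ x y : E, ‖gradient f x - gradient f y‖ ≤ L * ‖x - y‖) : Continuous (gradient f) := by
  refine (LipschitzWith.of_dist_le_mul (K := L.toNNReal) fun x y ↦ ?_).continuous
  rw [dist_eq_norm, dist_eq_norm]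
  exact (hlip x y).trans (mul_le_mul_of_nonneg_right (Real.le_coe_toNNReal L) (norm_nonneg _))

section Smooth

variable {f : E → ℝ} {L : ℝ} (hdiff : Differentiable ℝ f)
  (hlip : ∀ x y : E, ‖gradient f x - gradient f y‖ ≤ L * ‖x - y‖)

include hdiff hlip

/-- The descent lemma: a function with `L`-Lipschitz gradient is bounded above by its
quadratic model. -/
theorem le_add_inner_gradient_add_of_lipschitz (x d : E) :
    f (x + d) ≤ f x + ⟪gradient f x, d⟫ + L / 2 * ‖d‖ ^ 2 := by
  set φ : ℝ → ℝ := fun t ↦ f (x + t • d) - t * ⟪gradient f x, d⟫ - L / 2 * ‖d‖ ^ 2 * t ^ 2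
  have hder (t : ℝ) : HasDerivAt φ
      (⟪gradient f (x + t • d), d⟫ - ⟪gradient f x, d⟫ - L / 2 * ‖d‖ ^ 2 * (2 * t)) t := by
    refine ((HasGradientAt.hasDerivAt_comp (hdiff _).hasGradientAt
      (hasDerivAt_add_smul x d t)).sub ?_).sub ?_
    · simpa using (hasDerivAt_id t).mul_const ⟪gradient f x, d⟫
    · simpa using (hasDerivAt_pow 2 t).const_mul (L / 2 * ‖d‖ ^ 2)
  have hanti : AntitoneOn φ (Icc 0 1) := by
    refine antitoneOn_of_deriv_nonpos (convex_Icc 0 1)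
      (fun t _ ↦ (hder t).continuousAt.continuousWithinAt)
      (fun t _ ↦ (hder t).differentiableAt.differentiableWithinAt) fun t ht ↦ ?_
    rw [interior_Icc] at ht
    rw [(hder t).deriv, ← inner_sub_left]
    have h₁ := real_inner_le_norm (gradient f (x + t • d) - gradient f x) d
    have h₂ := hlip (x + t • d) x
    rw [add_sub_cancel_left, norm_smul, Real.norm_eq_abs, abs_of_pos ht.1] at h₂
    nlinarith [mul_le_mul_of_nonneg_right h₂ (norm_nonneg d)]
  have := hanti (left_mem_Icc.2 zero_le_one) (right_mem_Icc.2 zero_le_one) zero_le_one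
  simp [φ, -inner_gradient_left] at this
  linarith

/-- A lower bounded function with `L`-Lipschitz gradient satisfies
`‖∇f‖² ≤ 2L (f - inf f)`. -/
theorem norm_gradient_sq_le_of_lipschitz (hL : 0 < L) {y : E} (hmin : ∀ z, f y ≤ f z) (x : E) :
    ‖gradient f x‖ ^ 2 ≤ 2 * L * (f x - f y) := by
  have h₁ := le_add_inner_gradient_add_of_lipschitz hdiff hlip x (-(1 / L) • gradient f x)
  have h₂ := hmin (x + -(1 / L) • gradient f x)
  rw [inner_smul_right, real_inner_self_eq_norm_sq, norm_smul, mul_pow, norm_neg,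
    Real.norm_eq_abs, sq_abs] at h₁
  have h₃ : L / 2 * ((1 / L) ^ 2 * ‖gradient f x‖ ^ 2) = 1 / L * ‖gradient f x‖ ^ 2 / 2 := by
    field_simp
  have h₄ : 1 / L * ‖gradient f x‖ ^ 2 / 2 ≤ f x - f y := by linarith
  have h₅ : 2 * L * (1 / L * ‖gradient f x‖ ^ 2 / 2) = ‖gradient f x‖ ^ 2 := by field_simp
  rw [← h₅]
  exact mul_le_mul_of_nonneg_left h₄ (by positivity)

end Smooth

end Auxiliary

/-- Differentiation under the integral sign over a compact space. -/
theorem hasDerivAt_integral_of_continuous_of_compactSpace {K : Type*} [TopologicalSpace K]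
    [CompactSpace K] [MeasurableSpace K] [OpensMeasurableSpace K] {P : Measure K}
    [IsFiniteMeasure P] {F F' : ℝ → K → ℝ} (hF : ∀ t, Continuous (F t))
    (hF' : Continuous (Function.uncurry F')) (hder : ∀ t s, HasDerivAt (F · s) (F' t s) t)
    (t₀ : ℝ) : HasDerivAt (fun t ↦ ∫ s, F t s ∂P) (∫ s, F' t₀ s ∂P) t₀ := by
  have hint {g : K → ℝ} (hg : Continuous g) : Integrable g P :=
    hg.integrable_of_hasCompactSupport (HasCompactSupport.of_compactSpace g)
  obtain ⟨C, hC⟩ := ((isCompact_Icc (a := t₀ - 1) (b := t₀ + 1)).prod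
    (isCompact_univ (X := K))).exists_bound_of_continuousOn hF'.continuousOn
  refine (hasDerivAt_integral_of_dominated_loc_of_deriv_le (bound := fun _ ↦ C)
    (Icc_mem_nhds (sub_one_lt t₀) (lt_add_one t₀))
    (Eventually.of_forall fun t ↦ (hint (hF t)).aestronglyMeasurable) (hint (hF t₀))
    (hint (by fun_prop)).aestronglyMeasurable
    (Eventually.of_forall fun s t ht ↦ hC (t, s) ⟨ht, mem_univ _⟩)
    (integrable_const C) (Eventually.of_forall fun s t _ ↦ hder t s)).2

section Sphere

variable {E : Type*} [NormedAddCommGroup E] [InnerProductSpace ℝ E] [FiniteDimensional ℝ E]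
  [MeasurableSpace E] [BorelSpace E]

/-- A measure on the unit sphere is rotation invariant if its integrals are unchanged by
linear isometries. -/
def RotationInvariant (P : Measure (sphere (0 : E) 1)) : Prop :=
  ∀ (A : E ≃ₗᵢ[ℝ] E) (g : E → ℝ), ∫ s, g (A (s : E)) ∂P = ∫ s, g (s : E) ∂P

/-- The linear isometry `A` as a homeomorphism of the unit sphere. -/
def LinearIsometryEquiv.sphereHomeomorph (A : E ≃ₗᵢ[ℝ] E) :
    sphere (0 : E) 1 ≃ₜ sphere (0 : E) 1 :=
  A.toHomeomorph.subtype fun x ↦ by simp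

theorem rotationInvariant_toSphere : RotationInvariant (volume : Measure E).toSphere := by
  intro A g
  have hmp : MeasurePreserving A.sphereHomeomorph
      (volume : Measure E).toSphere (volume : Measure E).toSphere := by
    refine ⟨A.sphereHomeomorph.continuous.measurable, Measure.ext fun t ht ↦ ?_⟩
    rw [Measure.map_apply A.sphereHomeomorph.continuous.measurable ht,
      Measure.toSphere_apply' _ ht,
      Measure.toSphere_apply' _ (A.sphereHomeomorph.continuous.measurable ht)]
    congr 1
    have himage : ((↑) '' (A.sphereHomeomorph ⁻¹' t) : Set E) = A ⁻¹' ((↑) '' t) := by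
      ext y
      constructor
      · rintro ⟨s, hs, rfl⟩
        exact ⟨_, hs, rfl⟩
      · rintro ⟨s, hs, hsy⟩
        have hy : ‖y‖ = 1 := by rw [← A.norm_map, ← hsy]; exact norm_eq_of_mem_sphere s
        refine ⟨⟨y, by simpa using hy⟩, ?_, rfl⟩
        have : A.sphereHomeomorph ⟨y, by simpa using hy⟩ = s := Subtype.ext hsy.symm
        simpa [this] using hs
    have hsmul (u : Set E) : Ioo (0 : ℝ) 1 • (A ⁻¹' u) = A ⁻¹' (Ioo (0 : ℝ) 1 • u) := by
      ext y
      simp only [Set.mem_smul, mem_preimage]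
      constructor
      · rintro ⟨r, hr, z, hz, rfl⟩
        exact ⟨r, hr, A z, hz, by simp⟩
      · rintro ⟨r, hr, z, hz, hy⟩
        exact ⟨r, hr, A.symm z, by simpa using hz,
          (map_smul A.symm r z).symm.trans (A.symm_apply_eq.2 hy)⟩
    rw [himage, hsmul]
    exact A.measurePreserving.measure_preimage_equiv (f := A.toHomeomorph.toMeasurableEquiv) _
  exact hmp.integral_comp A.sphereHomeomorph.measurableEmbedding fun s ↦ g (s : E)

omit [FiniteDimensional ℝ E] [BorelSpace E] in
theorem RotationInvariant.smul {P : Measure (sphere (0 : E) 1)} (hP : RotationInvariant P)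
    (c : ENNReal) : RotationInvariant (c • P) := by
  intro A g
  rw [integral_smul_measure, integral_smul_measure, hP]

theorem integrable_sphere_of_continuous (P : Measure (sphere (0 : E) 1)) [IsFiniteMeasure P]
    {g : E → ℝ} (hg : Continuous g) : Integrable (fun s : sphere (0 : E) 1 ↦ g s) P :=
  (hg.comp continuous_subtype_val).integrable_of_hasCompactSupport
    (HasCompactSupport.of_compactSpace _)

namespace RotationInvariant

variable {P : Measure (sphere (0 : E) 1)} (hP : RotationInvariant P)

include hP

omit [FiniteDimensional ℝ E] [BorelSpace E] in
/-- The coordinates of a point of the sphere have mean zero. -/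
theorem integral_inner_eq_zero (v : E) : ∫ s, ⟪(s : E), v⟫ ∂P = 0 := by
  have := hP (LinearIsometryEquiv.neg ℝ) fun x ↦ ⟪x, v⟫
  simp [integral_neg] at this
  linarith

variable [IsProbabilityMeasure P]

/-- Infinitesimal rotation invariance. -/
theorem integral_inner_skewAdjoint_eq_zero {F : E → ℝ} {F' : E → E}
    (hF : ∀ x, HasGradientAt F (F' x) x) (hF' : Continuous F') {A : E →L[ℝ] E}
    (hA : A ∈ skewAdjoint (E →L[ℝ] E)) : ∫ s, ⟪F' (s : E), A s⟫ ∂P = 0 := by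
  let _ : NormedAlgebra ℚ (E →L[ℝ] E) := .restrictScalars ℚ ℝ _
  have hγ (t : ℝ) (x : E) : HasDerivAt (fun t : ℝ ↦ NormedSpace.exp (t • A) x)
      (NormedSpace.exp (t • A) (A x)) t := by
    simpa using (hasDerivAt_exp_smul_const A t).clm_apply (hasDerivAt_const t x)
  have hexp : Continuous fun t : ℝ ↦ NormedSpace.exp (t • A) :=
    continuous_iff_continuousAt.2 fun t ↦ (hasDerivAt_exp_smul_const A t).continuousAt
  have h_curve_deriv : Continuous fun p : ℝ × sphere (0 : E) 1 ↦ NormedSpace.exp (p.1 • A) (A p.2) :=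
    (hexp.comp continuous_fst).clm_apply (by fun_prop)
  have h_curve : Continuous fun p : ℝ × sphere (0 : E) 1 ↦ NormedSpace.exp (p.1 • A) p.2 :=
    (hexp.comp continuous_fst).clm_apply (by fun_prop)
  have hFc : Continuous F := continuous_iff_continuousAt.2 fun x ↦ (hF x).continuousAt
  have hder := hasDerivAt_integral_of_continuous_of_compactSpace (P := P)
    (F := fun t s ↦ F (NormedSpace.exp (t • A) (s : E)))
    (F' := fun t s ↦ ⟪F' (NormedSpace.exp (t • A) (s : E)), NormedSpace.exp (t • A) (A s)⟫)
    (fun t ↦ by fun_prop) ((hF'.comp h_curve).inner h_curve_deriv)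
    (fun t s ↦ HasGradientAt.hasDerivAt_comp (hF _) (hγ t s)) 0
  have hconst (t : ℝ) :
      ∫ s, F (NormedSpace.exp (t • A) (s : E)) ∂P = ∫ s, F (s : E) ∂P :=
    hP (Unitary.linearIsometryEquiv ⟨NormedSpace.exp (t • A),
      NormedSpace.exp_mem_unitary_of_mem_skewAdjoint (skewAdjoint.smul_mem t hA)⟩) F
  simp only [hconst, zero_smul, NormedSpace.exp_zero, one_apply_eq_self] at hder
  exact hder.unique (hasDerivAt_const 0 _)

/-- The divergence theorem for the tangential part of a constant vector field on the sphere. -/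
theorem integral_mul_inner_eq {F : E → ℝ} {F' : E → E}
    (hF : ∀ x, HasGradientAt F (F' x) x) (hF' : Continuous F') (v : E) :
    ((finrank ℝ E : ℝ) - 1) * ∫ s, F (s : E) * ⟪(s : E), v⟫ ∂P =
      ∫ s, ⟪F' (s : E), v⟫ ∂P - ∫ s, ⟪F' (s : E), s⟫ * ⟪(s : E), v⟫ ∂P := by
  have hFc : Continuous F := continuous_iff_continuousAt.2 fun x ↦ (hF x).continuousAt
  let b := stdOrthonormalBasis ℝ E
  let G (i : Fin (finrank ℝ E)) (s : E) : ℝ :=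
    ⟪F' s, v⟫ * (⟪s, b i⟫ * ⟪b i, s⟫) - ⟪F' s, b i⟫ * ⟪b i, s⟫ * ⟪s, v⟫ +
      F s * (⟪v, b i⟫ * ⟪b i, s⟫) - F s * ⟪s, v⟫
  have hskew (i : Fin (finrank ℝ E)) : ∫ s, G i (s : E) ∂P = 0 := by
    let A : E →L[ℝ] E :=
      (innerSL ℝ (b i)).smulRight v - (innerSL ℝ v).smulRight (b i)
    have hA : A ∈ skewAdjoint (E →L[ℝ] E) := by
      rw [skewAdjoint.mem_iff, ContinuousLinearMap.star_eq_adjoint, eq_comm,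
        ContinuousLinearMap.eq_adjoint_iff]
      intro x y
      simp [A, inner_sub_left, inner_sub_right, inner_smul_left, inner_smul_right,
        real_inner_comm]
      ring
    have hgrad (x : E) : HasGradientAt (fun x ↦ F x * ⟪b i, x⟫)
        (⟪b i, x⟫ • F' x + F x • b i) x := by
      rw [hasGradientAt_iff_hasFDerivAt]
      refine ((hF x).hasFDerivAt.mul (innerSL ℝ (b i)).hasFDerivAt).congr_fderiv ?_
      ext y
      simp
      ring
    rw [← hP.integral_inner_skewAdjoint_eq_zero hgrad (by fun_prop) hA]
    refine integral_congr_ae (Eventually.of_forall fun s ↦ ?_)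
    have hb : ⟪b i, b i⟫ = 1 := by simp
    have hAs : A s = ⟪b i, (s : E)⟫ • v - ⟪v, (s : E)⟫ • b i := by simp [A]
    simp only [G, hAs, inner_sub_right, inner_add_left, inner_smul_left, inner_smul_right,
      conj_trivial, real_inner_comm v (s : E), real_inner_comm (b i) (s : E),
      real_inner_comm (b i) v, hb]
    ring
  have hsum := Finset.sum_eq_zero fun i (_ : i ∈ Finset.univ) ↦ hskew i
  rw [← integral_finsetSum (f := fun i (s : sphere (0 : E) 1) ↦ G i s) _
    fun i _ ↦ integrable_sphere_of_continuous P (by fun_prop)] at hsum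
  have hpt (s : sphere (0 : E) 1) : ∑ i, G i (s : E) =
      ⟪F' (s : E), v⟫ - ⟪F' (s : E), s⟫ * ⟪(s : E), v⟫ -
        ((finrank ℝ E : ℝ) - 1) * (F s * ⟪(s : E), v⟫) := by
    have hs : ‖(s : E)‖ = 1 := norm_eq_of_mem_sphere s
    simp only [G, Finset.sum_sub_distrib, Finset.sum_add_distrib, ← Finset.mul_sum,
      ← Finset.sum_mul, b.sum_inner_mul_inner, real_inner_self_eq_norm_sq, hs,
      Finset.sum_const, Finset.card_univ, Fintype.card_fin, nsmul_eq_mul, real_inner_comm (s : E) v]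
    ring
  simp only [hpt] at hsum
  rw [integral_sub (integrable_sphere_of_continuous P
      (g := fun s ↦ ⟪F' s, v⟫ - ⟪F' s, s⟫ * ⟪s, v⟫) (by fun_prop))
    (integrable_sphere_of_continuous P
      (g := fun s ↦ ((finrank ℝ E : ℝ) - 1) * (F s * ⟪s, v⟫)) (by fun_prop)),
    integral_sub (integrable_sphere_of_continuous P (g := fun s ↦ ⟪F' s, v⟫) (by fun_prop))
    (integrable_sphere_of_continuous P (g := fun s ↦ ⟪F' s, s⟫ * ⟪s, v⟫) (by fun_prop)),
    integral_const_mul] at hsum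
  linarith

/-- The second moments of a point of the sphere. -/
theorem finrank_mul_integral_inner_sq (a : E) :
    (finrank ℝ E : ℝ) * ∫ s, ⟪(s : E), a⟫ ^ 2 ∂P = ‖a‖ ^ 2 := by
  have := hP.integral_mul_inner_eq (hasGradientAt_inner a) continuous_const a
  simp only [real_inner_comm _ a, ← sq, real_inner_self_eq_norm_sq, integral_const, probReal_univ,
    one_smul] at this
  linarith

section Radial

variable {f : E → ℝ} {f' : E → E} (hf : ∀ x, HasGradientAt f (f' x) x) (hf' : Continuous f')

include hf hf'

/-- The radial derivative of `r ^ n * 𝔼 f (x + r s) ⟪s, v⟫`. -/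
theorem hasDerivAt_pow_mul_integral (x v : E) {n : ℕ} (hn : finrank ℝ E = n + 1) (r : ℝ) :
    HasDerivAt (fun r ↦ r ^ n * ∫ s, f (x + r • (s : E)) * ⟪(s : E), v⟫ ∂P)
      (r ^ n * ∫ s, ⟪f' (x + r • (s : E)), v⟫ ∂P) r := by
  have hfc : Continuous f := continuous_iff_continuousAt.2 fun x ↦ (hf x).continuousAt
  have hder := hasDerivAt_integral_of_continuous_of_compactSpace (P := P)
    (F := fun r s ↦ f (x + r • (s : E)) * ⟪(s : E), v⟫)
    (F' := fun r s ↦ ⟪f' (x + r • (s : E)), s⟫ * ⟪(s : E), v⟫)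
    (fun t ↦ by fun_prop) (by unfold Function.uncurry; fun_prop)
    (fun t s ↦ (HasGradientAt.hasDerivAt_comp (hf _)
      (hasDerivAt_add_smul x (s : E) t)).mul_const _) r
  refine ((hasDerivAt_pow n r).mul hder).congr_deriv ?_
  have hgrad (y : E) : HasGradientAt (fun y ↦ f (x + r • y)) (r • f' (x + r • y)) y := by
    rw [hasGradientAt_iff_hasFDerivAt]
    refine ((hf (x + r • y)).hasFDerivAt.comp y
      (((hasFDerivAt_id y).const_smul r).const_add x)).congr_fderiv ?_
    ext z
    simp
  have hdiv := hP.integral_mul_inner_eq hgrad (by fun_prop) v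
  simp only [hn, Nat.cast_add, Nat.cast_one, add_sub_cancel_right, inner_smul_left,
    conj_trivial, mul_assoc, integral_const_mul] at hdiv
  rcases n with _ | n
  · simp only [Nat.cast_zero, zero_mul, pow_zero, one_mul, zero_add] at hdiv ⊢
    by_cases hr : r = 0
    · subst hr
      have h₀ := hP.integral_mul_inner_eq (hasGradientAt_inner (f' x)) continuous_const v
      simp only [hn, zero_add, Nat.cast_one, sub_self, zero_mul] at h₀
      simp only [zero_smul, add_zero]
      linarith
    · exact mul_left_cancel₀ hr (by linarith)
  · simp only [Nat.add_sub_cancel, pow_succ]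
    linear_combination r ^ n * hdiv

end Radial

section Step

variable {f : E → ℝ} {L : ℝ} (hconv : ConvexOn ℝ univ f) (hdiff : Differentiable ℝ f)
  (hlip : ∀ x y : E, ‖gradient f x - gradient f y‖ ≤ L * ‖x - y‖)

include hconv hdiff hlip

/-- For convex `f`, the mean of the directional derivative along `v` over a sphere dominates the
decrease of `f` along `v`, up to the smoothing error. -/
theorem le_integral_inner_gradient (x v : E) (r : ℝ) :
    f x - f (x - v) - L / 2 * r ^ 2 ≤ ∫ s, ⟪gradient f (x + r • (s : E)), v⟫ ∂P := by
  have hgc := continuous_gradient_of_lipschitz hlip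
  have hlin : ∫ s, ⟪(s : E), r • (gradient f x - gradient f (x - v))⟫ ∂P = 0 :=
    hP.integral_inner_eq_zero _
  have hint := integrable_sphere_of_continuous P
    (g := fun s ↦ ⟪s, r • (gradient f x - gradient f (x - v))⟫) (by fun_prop)
  calc f x - f (x - v) - L / 2 * r ^ 2
      = ∫ s, (⟪(s : E), r • (gradient f x - gradient f (x - v))⟫ +
          (f x - f (x - v) - L / 2 * r ^ 2)) ∂P := by
        rw [integral_add hint (integrable_const _), hlin]
        simp
    _ ≤ _ := by
        refine integral_mono (hint.add (integrable_const _))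
          (integrable_sphere_of_continuous P (g := fun s ↦ ⟪gradient f (x + r • s), v⟫)
            (by fun_prop)) fun s ↦ ?_
        have h₁ := hconv.add_inner_gradient_le hdiff (x + r • (s : E)) (-v)
        have h₂ := hconv.add_inner_gradient_le hdiff x (r • (s : E))
        have h₃ := le_add_inner_gradient_add_of_lipschitz hdiff hlip (x - v) (r • (s : E))
        rw [norm_smul, norm_eq_of_mem_sphere s, Real.norm_eq_abs, mul_one, sq_abs] at h₃
        rw [show x + r • (s : E) + -v = x - v + r • (s : E) by abel, inner_neg_right] at h₁
        simp only [inner_smul_right, inner_smul_left, inner_sub_left, conj_trivial,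
          real_inner_comm _ (s : E)] at h₁ h₂ h₃ ⊢
        linarith

/-- The mean of the gradient-free oracle `(m / r) f(x + r s) s`, tested against `v`,
dominates the decrease of `f` along `v`, up to the smoothing error. -/
theorem mul_le_finrank_mul_integral [Nontrivial E] (hL : 0 ≤ L) (x v : E) {r : ℝ} (hr : 0 < r) :
    r * (f x - f (x - v) - L / 2 * r ^ 2) ≤
      finrank ℝ E * ∫ s, f (x + r • (s : E)) * ⟪(s : E), v⟫ ∂P := by
  obtain ⟨n, hn⟩ := Nat.exists_eq_succ_of_ne_zero (finrank_pos (R := ℝ) (M := E)).ne'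
  set c := f x - f (x - v) - L / 2 * r ^ 2 with hc
  have hn0 : (n + 1 : ℝ) ≠ 0 := by positivity
  set Φ : ℝ → ℝ := fun t ↦
    t ^ n * ∫ s, f (x + t • (s : E)) * ⟪(s : E), v⟫ ∂P - c / (n + 1) * t ^ (n + 1) with hΦ
  have hder (t : ℝ) :
      HasDerivAt Φ (t ^ n * (∫ s, ⟪gradient f (x + t • (s : E)), v⟫ ∂P - c)) t := by
    refine ((hP.hasDerivAt_pow_mul_integral (fun x ↦ (hdiff x).hasGradientAt)
      (continuous_gradient_of_lipschitz hlip) x v hn t).sub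
        ((hasDerivAt_pow (n + 1) t).const_mul (c / (n + 1)))).congr_deriv ?_
    push_cast
    field_simp
  have hmono : MonotoneOn Φ (Icc 0 r) := by
    refine monotoneOn_of_deriv_nonneg (convex_Icc 0 r)
      (fun t _ ↦ (hder t).continuousAt.continuousWithinAt)
      (fun t _ ↦ (hder t).differentiableAt.differentiableWithinAt) fun t ht ↦ ?_
    rw [interior_Icc] at ht
    rw [(hder t).deriv]
    refine mul_nonneg (pow_nonneg ht.1.le n) (sub_nonneg.2 (le_trans ?_
      (hP.le_integral_inner_gradient hconv hdiff hlip x v t)))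
    have : t ^ 2 ≤ r ^ 2 := pow_le_pow_left₀ ht.1.le ht.2.le 2
    rw [hc]
    gcongr
  have hle := hmono (left_mem_Icc.2 hr.le) (right_mem_Icc.2 hr.le) hr.le
  have hzero : Φ 0 = 0 := by
    simp [hΦ, integral_const_mul, hP.integral_inner_eq_zero]
  rw [hzero, hΦ] at hle
  simp only at hle
  rw [hn]
  push_cast
  have hpos : 0 < r ^ n := pow_pos hr n
  generalize ∫ s, f (x + r • (s : E)) * ⟪(s : E), v⟫ ∂P = I at hle ⊢
  have h₁ : 0 ≤ r ^ n * (I - c / (n + 1) * r) := by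
    calc 0 ≤ r ^ n * I - c / (n + 1) * r ^ (n + 1) := hle
      _ = r ^ n * (I - c / (n + 1) * r) := by ring
  have h₂ : c / (n + 1) * r ≤ I := sub_nonneg.1 (nonneg_of_mul_nonneg_right h₁ hpos)
  calc r * c = (n + 1) * (c / (n + 1) * r) := by field_simp
    _ ≤ (n + 1) * I := by gcongr

end Step

end RotationInvariant

end Sphere

/-- The squared length of the gradient-free oracle, up to the factor `(m / μ)²`. -/
theorem sq_oracle_le {a r d e μ L δ : ℝ} (hr₀ : 0 ≤ r) (hr : r ≤ L / 2 * μ ^ 2) (hd : |d| ≤ δ)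
    (he : |e| ≤ δ) :
    (μ * a + r + (d - e)) ^ 2 ≤ 4 * μ ^ 2 * a ^ 2 + L ^ 2 * μ ^ 4 + 8 * δ ^ 2 := by
  have h₁ : r ^ 2 ≤ (L / 2 * μ ^ 2) ^ 2 := pow_le_pow_left₀ hr₀ hr 2
  have h₂ : d ^ 2 ≤ δ ^ 2 := sq_le_sq' (abs_le.1 hd).1 (abs_le.1 hd).2
  have h₃ : e ^ 2 ≤ δ ^ 2 := sq_le_sq' (abs_le.1 he).1 (abs_le.1 he).2
  nlinarith [sq_nonneg (μ * a - r), sq_nonneg (μ * a + r - (d - e)), sq_nonneg (d + e)]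

end

/-- one step of the gradient-type method with the biased gradient-free
oracle.  With `f` convex, `f ∈ C^{1,1}_L`, global minimizer `x*`, oracle error `≤ δ`,
`‖x₀ − x*‖ ≤ R`, `X = {u : ‖u − x₀‖ ≤ 2R}`, `h = 1/(8mL)`, `x ∈ X`,
`x⁺ = Π_X(x − h g_μ^δ(x))` for `s` uniform on the unit sphere,
`E[‖x⁺ − x*‖²] ≤ ‖x − x*‖² + Rδ/(μL) − (f(x) − f*)/(8mL) + μ²(m+8)/(64m) + δ²/(8μ²L²)`. -/
theorem one_step_bound_convex (m : ℕ) (hm : 1 ≤ m) (L μ δ R : ℝ)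
    (hL : 0 < L) (hμ : 0 < μ) (hδ : 0 ≤ δ) (hR : 0 < R)
    (f : EuclideanSpace ℝ (Fin m) → ℝ)
    (hconv : ConvexOn ℝ Set.univ f)
    (hdiff : Differentiable ℝ f)
    (hlip : ∀ x y : EuclideanSpace ℝ (Fin m),
      ‖gradient f x - gradient f y‖ ≤ L * ‖x - y‖)
    (xstar : EuclideanSpace ℝ (Fin m)) (hmin : ∀ y, f xstar ≤ f y)
    (δt : EuclideanSpace ℝ (Fin m) → ℝ) (hδt : ∀ u, |δt u| ≤ δ)
    (x₀ : EuclideanSpace ℝ (Fin m)) (hx₀ : ‖x₀ - xstar‖ ≤ R)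
    (x : EuclideanSpace ℝ (Fin m)) (hx : ‖x - x₀‖ ≤ 2 * R) :
    ⨍ s : sphere (0 : EuclideanSpace ℝ (Fin m)) 1,
        ‖projBall x₀ (2 * R)
            (x - (1 / (8 * m * L)) •
              ((((m : ℝ) / μ) *
                  ((f (x + μ • (s : EuclideanSpace ℝ (Fin m))) +
                      δt (x + μ • (s : EuclideanSpace ℝ (Fin m)))) - (f x + δt x))) •
                (s : EuclideanSpace ℝ (Fin m)))) - xstar‖ ^ 2
        ∂((volume : Measure (EuclideanSpace ℝ (Fin m))).toSphere) ≤
      ‖x - xstar‖ ^ 2 + R * δ / (μ * L) - (f x - f xstar) / (8 * m * L) +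
        μ ^ 2 * (m + 8) / (64 * m) + δ ^ 2 / (8 * μ ^ 2 * L ^ 2) := by
  have : Nontrivial (EuclideanSpace ℝ (Fin m)) :=
    Module.nontrivial_of_finrank_pos (R := ℝ) (by rw [finrank_euclideanSpace_fin]; exact hm)
  have hm0 : (0 : ℝ) < m := by exact_mod_cast hm
  set σ := (volume : Measure (EuclideanSpace ℝ (Fin m))).toSphere with hσ
  have : NeZero σ := ⟨Measure.toSphere_ne_zero _⟩
  rw [average]
  have hP : RotationInvariant ((σ Set.univ)⁻¹ • σ) := rotationInvariant_toSphere.smul _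
  have hPprob : IsProbabilityMeasure ((σ Set.univ)⁻¹ • σ) := inferInstance
  generalize (σ Set.univ)⁻¹ • σ = P at hP hPprob
  set v := x - xstar with hv
  have hvR : ‖v‖ ≤ 3 * R := by
    have := norm_sub_le_norm_sub_add_norm_sub x x₀ xstar
    linarith
  have hgc := continuous_gradient_of_lipschitz hlip
  have hfc : Continuous f := hdiff.continuous
  have hpoint (s : sphere (0 : EuclideanSpace ℝ (Fin m)) 1) :
      ‖projBall x₀ (2 * R) (x - (1 / (8 * m * L)) •
        (((m : ℝ) / μ) * ((f (x + μ • (s : EuclideanSpace ℝ (Fin m))) +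
          δt (x + μ • (s : EuclideanSpace ℝ (Fin m)))) - (f x + δt x))) •
            (s : EuclideanSpace ℝ (Fin m))) - xstar‖ ^ 2 ≤
      ‖v‖ ^ 2 + R * δ / (μ * L) + (L ^ 2 * μ ^ 4 + 8 * δ ^ 2) / (64 * μ ^ 2 * L ^ 2) +
        (f x + δt x) / (4 * μ * L) * inner ℝ (s : EuclideanSpace ℝ (Fin m)) v -
        1 / (4 * μ * L) * (f (x + μ • (s : EuclideanSpace ℝ (Fin m))) *
          inner ℝ (s : EuclideanSpace ℝ (Fin m)) v) +
        1 / (16 * L ^ 2) * inner ℝ (s : EuclideanSpace ℝ (Fin m)) (gradient f x) ^ 2 := by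
    have hs : ‖(s : EuclideanSpace ℝ (Fin m))‖ = 1 := norm_eq_of_mem_sphere s
    generalize (s : EuclideanSpace ℝ (Fin m)) = s at hs
    refine (pow_le_pow_left₀ (norm_nonneg _) (norm_projBall_sub_le (by positivity)
      (by rw [norm_sub_rev]; linarith) _) 2).trans ?_
    rw [sub_right_comm, ← hv, smul_smul, norm_sub_sq_real, norm_smul, hs, mul_one,
      Real.norm_eq_abs, sq_abs, inner_smul_right, real_inner_comm]
    have hlow := hconv.add_inner_gradient_le hdiff x (μ • s)
    have hupp := le_add_inner_gradient_add_of_lipschitz hdiff hlip x (μ • s)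
    rw [norm_smul, hs, Real.norm_eq_abs, mul_one, sq_abs] at hupp
    rw [inner_smul_right, real_inner_comm] at hlow hupp
    have hsq := sq_oracle_le (a := inner ℝ s (gradient f x)) (d := δt (x + μ • s)) (e := δt x)
      (r := f (x + μ • s) - (f x + μ * inner ℝ s (gradient f x))) (μ := μ) (L := L)
      (by linarith) (by linarith) (hδt _) (hδt _)
    have hdev : -(3 * R * δ) ≤ δt (x + μ • s) * inner ℝ s v := by
      refine neg_le_of_abs_le ?_
      rw [abs_mul, mul_comm (3 * R)]
      refine mul_le_mul (hδt _) ?_ (abs_nonneg _) hδ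
      have := abs_real_inner_le_norm s v
      rw [hs, one_mul] at this
      exact this.trans hvR
    generalize δt (x + μ • s) = d at hsq hdev
    generalize f (x + μ • s) = φ at hsq hlow hupp
    generalize inner ℝ s v = w at hdev
    generalize inner ℝ s (gradient f x) = a at hsq hlow hupp
    have h₁ : 0 ≤ 1 / (64 * μ ^ 2 * L ^ 2) * (4 * μ ^ 2 * a ^ 2 + L ^ 2 * μ ^ 4 + 8 * δ ^ 2 -
        (μ * a + (φ - (f x + μ * a)) + (d - δt x)) ^ 2) :=
      mul_nonneg (by positivity) (sub_nonneg.2 hsq)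
    have h₂ : 0 ≤ 1 / (4 * μ * L) * (d * w + 4 * R * δ) :=
      mul_nonneg (by positivity) (by nlinarith [mul_nonneg hR.le hδ])
    refine le_of_sub_nonneg (le_of_le_of_eq (add_nonneg h₁ h₂) ?_)
    field_simp
    ring
  have hmoment := hP.finrank_mul_integral_inner_sq (gradient f x)
  have horacle := hP.mul_le_finrank_mul_integral hconv hdiff hlip hL.le x v hμ
  have hgrad := norm_gradient_sq_le_of_lipschitz hdiff hlip hL hmin x
  rw [finrank_euclideanSpace_fin] at hmoment horacle
  rw [hv, sub_sub_cancel, ← hv] at horacle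
  have hint {g : EuclideanSpace ℝ (Fin m) → ℝ} (hg : Continuous g) :=
    integrable_sphere_of_continuous P hg
  have hi₁ := hint (g := fun s ↦ (f x + δt x) / (4 * μ * L) * inner ℝ s v) (by fun_prop)
  have hi₂ := hint (g := fun s ↦ 1 / (4 * μ * L) * (f (x + μ • s) * inner ℝ s v)) (by fun_prop)
  have hi₃ := hint (g := fun s ↦ 1 / (16 * L ^ 2) * inner ℝ s (gradient f x) ^ 2) (by fun_prop)
  set C := ‖v‖ ^ 2 + R * δ / (μ * L) + (L ^ 2 * μ ^ 4 + 8 * δ ^ 2) / (64 * μ ^ 2 * L ^ 2) with hC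
  have hi₄ : Integrable (fun s : sphere (0 : EuclideanSpace ℝ (Fin m)) 1 ↦
      C + (f x + δt x) / (4 * μ * L) * inner ℝ (s : EuclideanSpace ℝ (Fin m)) v) P :=
    (integrable_const C).add hi₁
  have hi₅ : Integrable (fun s : sphere (0 : EuclideanSpace ℝ (Fin m)) 1 ↦
      C + (f x + δt x) / (4 * μ * L) * inner ℝ (s : EuclideanSpace ℝ (Fin m)) v -
        1 / (4 * μ * L) * (f (x + μ • (s : EuclideanSpace ℝ (Fin m))) *
          inner ℝ (s : EuclideanSpace ℝ (Fin m)) v)) P := hi₄.sub hi₂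
  refine (integral_mono_of_nonneg (Filter.Eventually.of_forall fun s ↦ sq_nonneg _)
    (hi₅.add hi₃) (Filter.Eventually.of_forall hpoint)).trans ?_
  simp only [Pi.add_apply]
  rw [integral_add hi₅ hi₃, integral_sub hi₄ hi₂, integral_add (integrable_const _) hi₁,
    integral_const_mul, integral_const_mul, integral_const_mul, hP.integral_inner_eq_zero,
    integral_const, probReal_univ, one_smul, hC]
  generalize ∫ s, f (x + μ • (s : EuclideanSpace ℝ (Fin m))) *
    inner ℝ (s : EuclideanSpace ℝ (Fin m)) v ∂P = I at horacle ⊢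
  generalize ∫ s, inner ℝ (s : EuclideanSpace ℝ (Fin m)) (gradient f x) ^ 2 ∂P = J at hmoment ⊢
  have h₁ : 0 ≤ 1 / (4 * m * μ * L) * (m * I - μ * (f x - f xstar - L / 2 * μ ^ 2)) :=
    mul_nonneg (by positivity) (sub_nonneg.2 horacle)
  have h₂ : 0 ≤ 1 / (16 * m * L ^ 2) * (2 * L * (f x - f xstar) - m * J) :=
    mul_nonneg (by positivity) (sub_nonneg.2 (hmoment.trans_le hgrad))
  refine le_of_sub_nonneg (le_of_le_of_eq (add_nonneg h₁ h₂) ?_)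
  field_simp
  ring
end
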